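/- Let s be a positive divisor of 2n−2 with s ≠ n−1 and s ≠ 2n−2, and let p = gcd(n−1, s). Then the number of elements of NC^D(n) that are invariant under (σ∘ρ)^s equals C(2p, p). -/

import Mathlib

/-- The label set `[±n] = {i ∈ ℤ : 1 ≤ |i| ≤ n}`. -/
def signedSet (n : ℕ) : Set ℤ := {i : ℤ | 1 ≤ |i| ∧ |i| ≤ (n : ℤ)}

/-- The clockwise position (a number in `{0, 1, …, 2n-3}`) of a label `i` with `|i| ≠ n`:
the labels `1, …, n-1, -1, …, -(n-1)` are placed clockwise in this order. -/
noncomputable def posR (n : ℕ) (i : ℤ) : ℝ :=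
  if 0 < i then (i : ℝ) - 1 else ((n : ℝ) - 1) + (-(i : ℝ) - 1)

/-- The point `P(i)` of the plane carrying label `i`: the labels `1, …, n-1, -1, …, -(n-1)`
sit clockwise, in this order, at the vertices of a regular `(2n-2)`-gon centered at the
origin (the vertices of the unit circle at angles `-2πk/(2n-2)`), while the labels `n` and
`-n` both sit at the origin, its centroid. -/
noncomputable def pt (n : ℕ) (i : ℤ) : ℝ × ℝ :=
  if |i| = (n : ℤ) then (0, 0)
  else (Real.cos (-(2 * Real.pi * posR n i / (2 * (n : ℝ) - 2))),
        Real.sin (-(2 * Real.pi * posR n i / (2 * (n : ℝ) - 2))))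

/-- The convex hull `c(B)` of the set of points carrying the labels in `B`. -/
noncomputable def hullOf (n : ℕ) (B : Set ℤ) : Set (ℝ × ℝ) := convexHull ℝ (pt n '' B)

/-- Two blocks `B`, `B'` cross if their convex hulls do not coincide and one of the hulls
contains a point of the other in its relative interior. -/
def Crosses (n : ℕ) (B B' : Set ℤ) : Prop :=
  hullOf n B ≠ hullOf n B' ∧
    ((∃ x ∈ hullOf n B', x ∈ intrinsicInterior ℝ (hullOf n B)) ∨
     (∃ x ∈ hullOf n B, x ∈ intrinsicInterior ℝ (hullOf n B')))

/-- `w` is a set partition of `S ⊆ ℤ`. -/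
def IsPartitionOf (S : Set ℤ) (w : Set (Set ℤ)) : Prop :=
  (∀ B ∈ w, B.Nonempty) ∧ (∀ B ∈ w, B ⊆ S) ∧ ∀ x ∈ S, ∃! B, B ∈ w ∧ x ∈ B

/-- A `D_n`-partition: a set partition of `[±n]` such that `-B` is a block whenever `B` is,
at most one block (the zero block) contains some pair `i, -i`, and the zero block, if
present, is not of the form `{i, -i}` for a single `i`. -/
def IsDnPartition (n : ℕ) (w : Set (Set ℤ)) : Prop :=
  IsPartitionOf (signedSet n) w ∧
  (∀ B ∈ w, (fun i : ℤ => -i) '' B ∈ w) ∧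
  (∀ B ∈ w, ∀ B' ∈ w, (∃ i, i ∈ B ∧ -i ∈ B) → (∃ i, i ∈ B' ∧ -i ∈ B') → B = B') ∧
  (∀ B ∈ w, ∀ i : ℤ, B ≠ {i, -i})

/-- `NCD n` is the set of `D_n`-partitions in which no two blocks cross. -/
def NCD (n : ℕ) : Set (Set (Set ℤ)) :=
  {w | IsDnPartition n w ∧ ∀ B ∈ w, ∀ B' ∈ w, B ≠ B' → ¬ Crosses n B B'}

/-- The function underlying the permutation `ρ` of `[±n]`: the cycle
`(1, 2, …, n-1, -1, -2, …, -(n-1))`, fixing `n` and `-n`. -/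
def rhoFun (n : ℕ) (i : ℤ) : ℤ :=
  if 1 ≤ i ∧ i < (n : ℤ) - 1 then i + 1
  else if i = (n : ℤ) - 1 then -1
  else if -((n : ℤ) - 1) < i ∧ i ≤ -1 then i - 1
  else if i = -((n : ℤ) - 1) then 1
  else i

/-- The function underlying the permutation `σ` of `[±n]`: the transposition exchanging
`n` and `-n`. -/
def sigmaFun (n : ℕ) (i : ℤ) : ℤ :=
  if i = (n : ℤ) then -(n : ℤ) else if i = -(n : ℤ) then (n : ℤ) else i

/-- A partition `w` is invariant under `g` if the image partition under `g` equals `w`. -/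
def InvUnder (g : ℤ → ℤ) (w : Set (Set ℤ)) : Prop := (fun B => g '' B) '' w = w


structure IsT (p k : ℕ) (E : ℤ → ℤ → Prop) : Prop where
  refl : ∀ x, E x x
  symm : ∀ x y, E x y → E y x
  trans : ∀ x y z, E x y → E y z → E x z
  per : ∀ x, E x (x + k * p)
  inv : ∀ x y, E x y ↔ E (x + p) (y + p)
  nc : ∀ x y z t : ℤ, x < y → y < z → z < t → t < x + k * p → E x z → E y t → E x y

/-- consecutive elements at distance at most `p`. -/
def Nxt (p : ℕ) (E : ℤ → ℤ → Prop) (x y : ℤ) : Prop :=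
  x < y ∧ y ≤ x + p ∧ E x y ∧ ∀ z, x < z → z < y → ¬ E x z

lemma IsT.inv_mul {p k : ℕ} {E : ℤ → ℤ → Prop} (h : IsT p k E) (j x y : ℤ) :
    E x y ↔ E (x + j * p) (y + j * p) := by
  induction j using Int.induction_on with
  | zero => simp
  | succ i ih =>
    rw [ih, h.inv]
    have : ∀ x : ℤ, x + i * p + p = x + (i + 1) * p := fun x => by ring
    rw [this, this]
  | pred i ih =>
    rw [ih, h.inv (x + (-(i:ℤ) - 1) * p)]
    have : ∀ x : ℤ, x + (-(i:ℤ) - 1) * p + p = x + (-(i:ℤ)) * p := fun x => by ring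
    rw [this, this]

lemma IsT.per_mul {p k : ℕ} {E : ℤ → ℤ → Prop} (h : IsT p k E) (j x : ℤ) :
    E x (x + j * (k * p)) := by
  induction j using Int.induction_on with
  | zero => simpa using h.refl x
  | succ i ih =>
    have := h.trans _ _ _ ih (h.per _)
    convert this using 1; ring
  | pred i ih =>
    have := h.per (x + (-(i:ℤ) - 1) * (k * p))
    refine h.trans _ _ _ ih (h.symm _ _ ?_)
    convert this using 1; ring

lemma IsT.cen_mul {p k : ℕ} {E : ℤ → ℤ → Prop} (h : IsT p k E) {x : ℤ} (hx : E x (x + p)) (j : ℤ) :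
    E x (x + j * p) := by
  induction j using Int.induction_on with
  | zero => simpa using h.refl x
  | succ i ih =>
    have := h.trans _ _ _ ih ((h.inv_mul i _ _).1 hx)
    convert this using 1; ring
  | pred i ih =>
    have := ((h.inv_mul (-(i:ℤ) - 1) _ _).1 hx)
    refine h.trans _ _ _ ih (h.symm _ _ ?_)
    convert this using 1; ring

def LL (p : ℕ) (E : ℤ → ℤ → Prop) (x : ℤ) : Prop := ∀ y, x - p ≤ y → y < x → ¬ E y x
def RR (p : ℕ) (E : ℤ → ℤ → Prop) (x : ℤ) : Prop := ∀ y, x < y → y ≤ x + p → ¬ E x y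

section
variable {p k : ℕ} {E : ℤ → ℤ → Prop} (h : IsT p k E)
include h

lemma not_RR_iff (x : ℤ) : ¬ RR p E x ↔ ∃ y, Nxt p E x y := by
  constructor
  · intro hx
    unfold RR at hx; push Not at hx
    obtain ⟨y, hy⟩ := hx
    obtain ⟨y0, h0, h1⟩ := Int.exists_least_of_bdd (P := fun y => x < y ∧ y ≤ x + p ∧ E x y)
      ⟨x, fun z hz => hz.1.le⟩ ⟨y, hy⟩
    exact ⟨y0, h0.1, h0.2.1, h0.2.2, fun z hz hz' hE => by
      have := h1 z ⟨hz, by lia, hE⟩; lia⟩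
  · rintro ⟨y, h1, h2, h3, _⟩ hr
    exact hr y h1 h2 h3

lemma not_LL_iff (x : ℤ) : ¬ LL p E x ↔ ∃ y, Nxt p E y x := by
  constructor
  · intro hx
    unfold LL at hx; push Not at hx
    obtain ⟨y, hy⟩ := hx
    obtain ⟨y0, h0, h1⟩ := Int.exists_greatest_of_bdd (P := fun y => x - p ≤ y ∧ y < x ∧ E y x)
      ⟨x, fun z hz => hz.2.1.le⟩ ⟨y, hy⟩
    exact ⟨y0, h0.2.1, by lia, h0.2.2, fun z hz hz' hE => by
      have := h1 z ⟨by lia, hz', h.trans _ _ _ (h.symm _ _ hE) h0.2.2⟩; lia⟩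
  · rintro ⟨y, h1, h2, h3, _⟩ hr
    exact hr y (by lia) h1 h3

lemma Nxt.right {x y y' : ℤ} (h1 : Nxt p E x y) (h2 : Nxt p E x y') : y = y' := by
  rcases lt_trichotomy y y' with hh | hh | hh
  · exact absurd h1.2.2.1 (h2.2.2.2 y h1.1 hh)
  · exact hh
  · exact absurd h2.2.2.1 (h1.2.2.2 y' h2.1 hh)

lemma Nxt.left {x x' y : ℤ} (h1 : Nxt p E x y) (h2 : Nxt p E x' y) : x = x' := by
  rcases lt_trichotomy x x' with hh | hh | hh
  · exact absurd (h.trans _ _ _ h1.2.2.1 (h.symm _ _ h2.2.2.1)) (h1.2.2.2 x' hh h2.1)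
  · exact hh
  · exact absurd (h.trans _ _ _ h2.2.2.1 (h.symm _ _ h1.2.2.1)) (h2.2.2.2 x hh h1.1)

lemma Nxt.shift {x y : ℤ} (h1 : Nxt p E x y) (j : ℤ) : Nxt p E (x + j * p) (y + j * p) := by
  obtain ⟨a, b, c, d⟩ := h1
  refine ⟨by lia, by lia, (h.inv_mul j _ _).1 c, fun z hz hz' hE => d (z - j * p) (by lia) (by lia) ?_⟩
  rw [h.inv_mul j]; simpa using hE

lemma LL_shift (x j : ℤ) : LL p E (x + j * p) ↔ LL p E x := by
  rw [← not_iff_not, not_LL_iff h, not_LL_iff h]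
  constructor
  · rintro ⟨y, hy⟩
    have := Nxt.shift h hy (-j)
    exact ⟨_, by convert this using 1; ring⟩
  · rintro ⟨y, hy⟩
    exact ⟨_, Nxt.shift h hy j⟩

lemma RR_shift (x j : ℤ) : RR p E (x + j * p) ↔ RR p E x := by
  rw [← not_iff_not, not_RR_iff h, not_RR_iff h]
  constructor
  · rintro ⟨y, hy⟩
    have := Nxt.shift h hy (-j)
    exact ⟨_, by convert this using 1; ring⟩
  · rintro ⟨y, hy⟩
    exact ⟨_, Nxt.shift h hy j⟩

end

open Classical in
noncomputable def LF (p : ℕ) [NeZero p] (E : ℤ → ℤ → Prop) : Finset (ZMod p) :=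
  Finset.univ.filter (fun a => ∃ x : ℤ, (x : ZMod p) = a ∧ LL p E x)

open Classical in
noncomputable def RF (p : ℕ) [NeZero p] (E : ℤ → ℤ → Prop) : Finset (ZMod p) :=
  Finset.univ.filter (fun a => ∃ x : ℤ, (x : ZMod p) = a ∧ RR p E x)

lemma zmod_eq {p : ℕ} {x y : ℤ} : (x : ZMod p) = y ↔ ∃ j : ℤ, y = x + j * p := by
  rw [ZMod.intCast_eq_intCast_iff_dvd_sub]
  constructor
  · rintro ⟨c, hc⟩; exact ⟨c, by linarith⟩
  · rintro ⟨c, hc⟩; exact ⟨c, by linarith⟩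

section
variable {p k : ℕ} [NeZero p] {E : ℤ → ℤ → Prop} (h : IsT p k E)
include h

lemma mem_LF (x : ℤ) : (x : ZMod p) ∈ LF p E ↔ LL p E x := by
  unfold LF; simp only [Finset.mem_filter, Finset.mem_univ, true_and]
  constructor
  · rintro ⟨y, hy, hL⟩
    obtain ⟨j, rfl⟩ := zmod_eq.1 hy
    rwa [LL_shift h]
  · intro hL; exact ⟨x, rfl, hL⟩

lemma mem_RF (x : ℤ) : (x : ZMod p) ∈ RF p E ↔ RR p E x := by
  unfold RF; simp only [Finset.mem_filter, Finset.mem_univ, true_and]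
  constructor
  · rintro ⟨y, hy, hL⟩
    obtain ⟨j, rfl⟩ := zmod_eq.1 hy
    rwa [RR_shift h]
  · intro hL; exact ⟨x, rfl, hL⟩

lemma card_LF_eq : (LF p E).card = (RF p E).card := by
  have key : ((RF p E)ᶜ).card = ((LF p E)ᶜ).card := by
    have hex : ∀ a : ZMod p, a ∈ (RF p E)ᶜ → ∃ x y : ℤ, (x : ZMod p) = a ∧ Nxt p E x y := by
      intro a ha
      obtain ⟨x, rfl⟩ := ZMod.intCast_surjective a
      rw [Finset.mem_compl, mem_RF h, not_RR_iff h] at ha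
      obtain ⟨y, hy⟩ := ha
      exact ⟨x, y, rfl, hy⟩
    choose! f g hf hg using hex
    refine Finset.card_bij (fun a _ => (g a : ZMod p)) ?_ ?_ ?_
    · intro a ha
      rw [Finset.mem_compl, mem_LF h, not_LL_iff h]
      exact ⟨_, hg a ha⟩
    · intro a ha b hb hab
      obtain ⟨j, hj⟩ := zmod_eq.1 hab
      rw [← hf a ha, ← hf b hb, zmod_eq]
      refine ⟨j, ?_⟩
      have h1 := Nxt.shift h (hg a ha) j
      rw [← hj] at h1
      exact Nxt.left h (hg b hb) h1
    · intro b hb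
      obtain ⟨y, rfl⟩ := ZMod.intCast_surjective b
      rw [Finset.mem_compl, mem_LF h, not_LL_iff h] at hb
      obtain ⟨x, hx⟩ := hb
      have hxm : (x : ZMod p) ∈ (RF p E)ᶜ := by
        rw [Finset.mem_compl, mem_RF h, not_RR_iff h]; exact ⟨_, hx⟩
      refine ⟨(x : ZMod p), hxm, ?_⟩
      obtain ⟨j, hj⟩ := zmod_eq.1 (hf _ hxm)
      rw [zmod_eq]
      refine ⟨j, ?_⟩
      have h1 := Nxt.shift h (hg _ hxm) j
      rw [← hj] at h1
      exact Nxt.right h hx h1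
  rw [Finset.card_compl, Finset.card_compl] at key
  have h1 := Finset.card_le_univ (RF p E)
  have h2 := Finset.card_le_univ (LF p E)
  omega

end

lemma exists_e {p : ℕ} [NeZero p] (A B : Finset (ZMod p)) (hc : A.card = B.card) :
    ∃ e : ℤ → ℤ, (∀ x, e (x + p) = e x) ∧
      ∀ x : ℤ, e (x + 1) = e x + (if (x : ZMod p) ∈ A then 1 else 0)
        - (if (x : ZMod p) ∈ B then 1 else 0) := by
  have hp : (0:ℤ) < p := by have := NeZero.pos p; exact_mod_cast this
  let f : ℤ → ℤ := fun x => (if (x : ZMod p) ∈ A then 1 else 0) - (if (x : ZMod p) ∈ B then 1 else 0)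
  have hs : ∑ i ∈ Finset.range p, f i = 0 := by
    have h1 : ∑ i ∈ Finset.range p, f i = ∑ a : ZMod p, ((if a ∈ A then (1:ℤ) else 0) - (if a ∈ B then 1 else 0)) := by
      refine Finset.sum_bij (fun i _ => (i : ZMod p)) (by simp) ?_ ?_ ?_
      · intro a ha b hb hab
        rw [ZMod.natCast_eq_natCast_iff] at hab
        exact Nat.ModEq.eq_of_lt_of_lt hab (by simpa using ha) (by simpa using hb)
      · intro b _
        exact ⟨b.val, by simpa using ZMod.val_lt b, by simp⟩
      · intro a _
        simp [f]
    rw [h1, Finset.sum_sub_distrib]; simp [hc]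
  have hfper : ∀ x : ℤ, f (x % p) = f x := by
    intro x; simp [f]
  refine ⟨fun x => ∑ i ∈ Finset.range (x % p).toNat, f i, ?_, ?_⟩
  · intro x; simp
  · intro x
    have h0 := Int.emod_nonneg x hp.ne'
    have h1 := Int.emod_lt_of_pos x hp
    have h3 : f x = (if (x : ZMod p) ∈ A then 1 else 0) - (if (x : ZMod p) ∈ B then 1 else 0) := rfl
    rw [add_sub_assoc, ← h3]
    have h4 : ∑ i ∈ Finset.range (x % p).toNat, f i + f x = ∑ i ∈ Finset.range ((x % p).toNat + 1), f i := by
      rw [Finset.sum_range_succ, Int.toNat_of_nonneg h0, hfper]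
    simp only
    rw [h4]
    by_cases hx : x % p + 1 < p
    · have : (x + 1) % p = x % p + 1 := by
        rw [Int.add_emod, ← Int.emod_emod_of_dvd x (dvd_refl (p:ℤ))]
        rw [Int.emod_eq_of_lt (a := 1) (by norm_num) (by lia)]
        rw [Int.emod_emod_of_dvd x (dvd_refl (p:ℤ))]
        exact Int.emod_eq_of_lt (by lia) hx
      rw [this]
      congr 2; lia
    · have h5 : (x % p).toNat + 1 = p := by lia
      have : (x + 1) % p = 0 := by
        have := Int.emod_add_mul_ediv x p
        apply Int.emod_eq_zero_of_dvd
        exact ⟨x / p + 1, by linarith [show x % p + 1 = p by lia]⟩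
      rw [this, h5, hs]; simp



section
variable {p k : ℕ} [NeZero p]

lemma tel (A B : Finset (ZMod p)) (e : ℤ → ℤ)
    (he : ∀ x : ℤ, e (x + 1) = e x + (if (x : ZMod p) ∈ A then 1 else 0)
        - (if (x : ZMod p) ∈ B then 1 else 0)) (d : ℤ → ℤ)
    (hd : ∀ x : ℤ, d x = e x + (if (x : ZMod p) ∈ A then 1 else 0)) (x z : ℤ) (hxz : x ≤ z) :
    d z - d x = (((Finset.Ico x z).filter (fun u : ℤ => (u : ZMod p) ∉ B)).card : ℤ)
      - ((Finset.Ioc x z).filter (fun u : ℤ => (u : ZMod p) ∉ A)).card := by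
  induction z, hxz using Int.leInduction with
  | base => simp
  | succ z hz ih =>
    have h1 : Finset.Ico x (z + 1) = insert z (Finset.Ico x z) := by
      ext u; simp only [Finset.mem_Ico, Finset.mem_insert]; lia
    have h2 : Finset.Ioc x (z + 1) = insert (z + 1) (Finset.Ioc x z) := by
      ext u; simp only [Finset.mem_Ioc, Finset.mem_insert]; lia
    rw [h1, h2, Finset.filter_insert, Finset.filter_insert]
    have hz1 : z ∉ (Finset.Ico x z).filter (fun u : ℤ => (u : ZMod p) ∉ B) := by simp
    have hz2 : z + 1 ∉ (Finset.Ioc x z).filter (fun u : ℤ => (u : ZMod p) ∉ A) := by simp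
    have e1 := hd z
    have e2 := hd (z + 1)
    have e3 := he z
    by_cases c1 : (z : ZMod p) ∈ B <;> by_cases c2 : ((z + 1 : ℤ) : ZMod p) ∈ A <;>
      simp only [c1, c2, if_true, if_false, not_true, not_false_iff,
        Finset.card_insert_of_notMem hz1, Finset.card_insert_of_notMem hz2] at e1 e2 e3 ⊢ <;>
      push_cast <;> lia

lemma nxt_char {E : ℤ → ℤ → Prop} (h : IsT p k E) (hk : 4 ≤ k) (e : ℤ → ℤ)
    (he : ∀ x : ℤ, e (x + 1) = e x + (if (x : ZMod p) ∈ LF p E then 1 else 0)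
        - (if (x : ZMod p) ∈ RF p E then 1 else 0)) (d : ℤ → ℤ)
    (hd : ∀ x : ℤ, d x = e x + (if (x : ZMod p) ∈ LF p E then 1 else 0)) (x y : ℤ)
    (hxy : Nxt p E x y) : d y ≤ d x ∧ ∀ z, x < z → z < y → d x < d z := by
  have hp : (0:ℤ) < p := by have := NeZero.pos p; exact_mod_cast this
  have hkp : 4 * (p:ℤ) ≤ k * p := by
    have : (4:ℤ) ≤ k := by exact_mod_cast hk
    nlinarith
  -- noncrossing consequences
  have nest : ∀ u v, Nxt p E u v → x < u → u < y → v ≤ y := by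
    intro u v huv h1 h2
    by_contra hc
    push Not at hc
    have := h.nc x u y v h1 h2 hc (by have := huv.2.1; have := hxy.2.1; lia) hxy.2.2.1 huv.2.2.1
    exact hxy.2.2.2 u h1 h2 this
  have nest' : ∀ u v, Nxt p E u v → x < v → v < y → x < u := by
    intro u v huv h1 h2
    by_contra hc
    push Not at hc
    rcases hc.lt_or_eq with hc | hc
    · have := h.nc u x v y hc h1 h2 (by have := huv.2.1; have := hxy.2.1; lia) huv.2.2.1 hxy.2.2.1
      exact huv.2.2.2 x hc h1 this
    · subst hc
      have := Nxt.right h huv hxy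
      lia
  constructor
  · have := tel _ _ e he d hd x y hxy.1.le
    have hle : ((Finset.Ico x y).filter (fun u : ℤ => (u : ZMod p) ∉ RF p E)).card ≤
        ((Finset.Ioc x y).filter (fun u : ℤ => (u : ZMod p) ∉ LF p E)).card := by
      have hex : ∀ u : ℤ, (u : ZMod p) ∉ RF p E → ∃ v, Nxt p E u v := by
        intro u hu; rwa [mem_RF h, not_RR_iff h] at hu
      choose! g hg using hex
      refine Finset.card_le_card_of_injOn g ?_ ?_
      · intro u hu
        simp only [Finset.coe_filter, Finset.mem_Ico, Finset.mem_Ioc, Set.mem_ofPred_eq] at hu ⊢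
        have hgu := hg u hu.2
        refine ⟨⟨by have := hgu.1; lia, ?_⟩, ?_⟩
        · rcases hu.1.1.lt_or_eq with h1 | h1
          · exact nest _ _ hgu h1 hu.1.2
          · rw [← h1] at hgu ⊢; exact (Nxt.right h hgu hxy).le
        · rw [mem_LF h, not_LL_iff h]; exact ⟨_, hgu⟩
      · intro u hu v hv huv
        simp only [Finset.coe_filter, Finset.mem_Ico, Set.mem_ofPred_eq] at hu hv
        have h1 := hg u hu.2
        have h2 := hg v hv.2
        rw [huv] at h1
        exact Nxt.left h h1 h2
    lia
  · intro z hz1 hz2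
    have := tel _ _ e he d hd x z hz1.le
    have hle : ((Finset.Ioc x z).filter (fun u : ℤ => (u : ZMod p) ∉ LF p E)).card <
        ((Finset.Ico x z).filter (fun u : ℤ => (u : ZMod p) ∉ RF p E)).card := by
      have hex : ∀ u : ℤ, (u : ZMod p) ∉ LF p E → ∃ v, Nxt p E v u := by
        intro u hu; rwa [mem_LF h, not_LL_iff h] at hu
      choose! g hg using hex
      have hxm : x ∈ (Finset.Ico x z).filter (fun u : ℤ => (u : ZMod p) ∉ RF p E) := by
        simp only [Finset.mem_filter, Finset.mem_Ico]
        refine ⟨⟨le_refl _, hz1⟩, ?_⟩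
        rw [mem_RF h, not_RR_iff h]; exact ⟨_, hxy⟩
      rw [← Finset.card_erase_add_one hxm, Nat.lt_succ_iff]
      refine Finset.card_le_card_of_injOn g ?_ ?_
      · intro u hu
        simp only [Finset.coe_filter, Finset.coe_erase, Finset.mem_Ico, Finset.mem_Ioc, Set.mem_ofPred_eq,
          Set.mem_sdiff, Set.mem_singleton_iff] at hu ⊢
        have hgu := hg u hu.2
        have h3 := nest' _ _ hgu hu.1.1 (by lia)
        refine ⟨⟨⟨h3.le, by have := hgu.1; lia⟩, ?_⟩, by lia⟩
        rw [mem_RF h, not_RR_iff h]; exact ⟨_, hgu⟩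
      · intro u hu v hv huv
        simp only [Finset.coe_filter, Finset.mem_Ioc, Set.mem_ofPred_eq] at hu hv
        have h1 := hg u hu.2
        have h2 := hg v hv.2
        rw [huv] at h1
        exact Nxt.right h h1 h2
    lia

lemma nxt_eq {E E' : ℤ → ℤ → Prop} (h : IsT p k E) (h' : IsT p k E') (hk : 4 ≤ k)
    (hL : LF p E = LF p E') (hR : RF p E = RF p E') (x y : ℤ) (hxy : Nxt p E x y) : Nxt p E' x y := by
  obtain ⟨e, -, he⟩ := exists_e (LF p E) (RF p E) (card_LF_eq h)
  have c1 := nxt_char h hk e he _ (fun x => rfl) x y hxy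
  have hx : (x : ZMod p) ∉ RF p E' := by
    rw [← hR, mem_RF h, not_RR_iff h]; exact ⟨_, hxy⟩
  rw [mem_RF h', not_RR_iff h'] at hx
  obtain ⟨y', hy'⟩ := hx
  rw [hL, hR] at he
  rw [hL] at c1
  have c2 := nxt_char h' hk e he _ (fun x => rfl) x y' hy'
  rcases lt_trichotomy y y' with hh | hh | hh
  · have := c2.2 y hxy.1 hh; have := c1.1; lia
  · rwa [hh]
  · have := c1.2 y' hy'.1 hh; have := c2.1; lia

omit [NeZero p] in
/-- Walk along `Nxt` from `x` towards `y`. -/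
lemma chain {E E' : ℤ → ℤ → Prop} (h : IsT p k E) (h' : IsT p k E')
    (hN : ∀ x y, Nxt p E x y → Nxt p E' x y) (n : ℕ) : ∀ (x y : ℤ), x ≤ y → y - x ≤ n → E x y →
    E' x y ∨ ∃ r, x ≤ r ∧ r < y ∧ E x r ∧ RR p E r := by
  induction n with
  | zero => intro x y h1 h2 _; left; rw [show x = y by lia]; exact h'.refl _
  | succ n ih =>
    intro x y h1 h2 hE
    rcases h1.lt_or_eq with h1 | h1
    swap
    · subst h1; left; exact h'.refl _
    by_cases hr : RR p E x
    · right; exact ⟨x, le_refl _, h1, h.refl _, hr⟩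
    · obtain ⟨u, hu⟩ := (not_RR_iff h x).1 hr
      have huy : u ≤ y := by
        by_contra hc; push Not at hc
        exact hu.2.2.2 y h1 hc hE
      have := hu.1
      rcases ih u y huy (by lia) (h.trans _ _ _ (h.symm _ _ hu.2.2.1) hE) with h3 | ⟨r, r1, r2, r3, r4⟩
      · left; exact h'.trans _ _ _ (hN _ _ hu).2.2.1 h3
      · right; exact ⟨r, by lia, r2, h.trans _ _ _ hu.2.2.1 r3, r4⟩

lemma E_imp {E E' : ℤ → ℤ → Prop} (h : IsT p k E) (h' : IsT p k E') (hk : 4 ≤ k)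
    (hL : LF p E = LF p E') (hR : RF p E = RF p E') (x y : ℤ) (hxy : E x y) : E' x y := by
  have hp : (0:ℤ) < p := by have := NeZero.pos p; exact_mod_cast this
  have hkp : 4 * (p:ℤ) ≤ k * p := by
    have : (4:ℤ) ≤ k := by exact_mod_cast hk
    nlinarith
  have hN := nxt_eq h h' hk hL hR
  -- reduce y
  obtain ⟨j, hj1, hj2⟩ : ∃ j : ℤ, x ≤ y + j * (k * p) ∧ y + j * (k * p) < x + k * p := by
    refine ⟨-((y - x) / (k * p)), ?_, ?_⟩
    · have := Int.emod_nonneg (y - x) (b := k * p) (by lia)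
      have := Int.emod_add_mul_ediv (y - x) (k * p)
      linarith
    · have := Int.emod_lt_of_pos (y - x) (b := k * p) (by lia)
      have := Int.emod_add_mul_ediv (y - x) (k * p)
      linarith
  suffices hs : ∀ y, x ≤ y → y < x + k * p → E x y → E' x y by
    have h1 := hs _ hj1 hj2 (h.trans _ _ _ hxy (h.per_mul j y))
    exact h'.trans _ _ _ h1 (h'.symm _ _ (h'.per_mul j y))
  clear hxy hj1 hj2
  intro y h1 h2 hE
  rcases chain h h' hN (y - x).toNat x y h1 (by lia) hE with h3 | ⟨r, r1, r2, r3, r4⟩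
  · exact h3
  have hE2 : E y (x + k * p) := h.trans _ _ _ (h.symm _ _ hE) (h.per x)
  rcases chain h h' hN (x + k * p - y).toNat y (x + k * p) h2.le (by lia) hE2 with h3 | ⟨t, t1, t2, t3, t4⟩
  · exact h'.trans _ _ _ (h'.per x) (h'.symm _ _ h3)
  exfalso
  have a1 : r + p < y := by
    by_contra hc
    exact r4 y r2 (by lia) (h.trans _ _ _ (h.symm _ _ r3) hE)
  have a2 : t + p < x + k * p := by
    by_contra hc
    exact t4 (x + k * p) t2 (by lia) (h.trans _ _ _ (h.symm _ _ t3) hE2)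
  have hrt : E r t := h.trans _ _ _ (h.symm _ _ r3) (h.trans _ _ _ hE t3)
  have := h.nc r (r + p) t (t + p) (by lia) (by lia) (by lia) (by lia) hrt ((h.inv _ _).1 hrt)
  exact r4 (r + p) (by lia) (le_refl _) this

end



def sim (e d : ℤ → ℤ) (x y : ℤ) : Prop := d x = d y ∧ ∀ z, min x y < z → z ≤ max x y → d x ≤ e z

section
variable {p k : ℕ} [NeZero p] {e d : ℤ → ℤ}

omit [NeZero p] in
lemma ed_per_mul (he : ∀ x, e (x + p) = e x) (j x : ℤ) : e (x + j * p) = e x := by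
  induction j using Int.induction_on with
  | zero => simp
  | succ i ih => rw [← ih, ← he (x + i * p)]; congr 1; ring
  | pred i ih => rw [← ih, ← he (x + (-(i:ℤ) - 1) * p)]; congr 1; ring

lemma sim_symm {x y : ℤ} (h : sim e d x y) : sim e d y x := by
  refine ⟨h.1.symm, fun z h1 h2 => ?_⟩
  rw [min_comm] at h1; rw [max_comm] at h2
  rw [← h.1]; exact h.2 z h1 h2

lemma sim_trans {x y w : ℤ} (h1 : sim e d x y) (h2 : sim e d y w) : sim e d x w := by
  refine ⟨h1.1.trans h2.1, fun z a b => ?_⟩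
  by_cases hc : min x y < z ∧ z ≤ max x y
  · exact h1.2 z hc.1 hc.2
  · rw [h1.1]; exact h2.2 z (by grind) (by grind)

lemma sim_shift (he : ∀ x, e (x + p) = e x) (hd : ∀ x, d (x + p) = d x) (j : ℤ) {x y : ℤ}
    (h : sim e d x y) : sim e d (x + j * p) (y + j * p) := by
  refine ⟨?_, fun z a b => ?_⟩
  · rw [ed_per_mul hd, ed_per_mul hd]; exact h.1
  · rw [ed_per_mul hd, ← ed_per_mul he (-j) z]
    exact h.2 _ (by grind) (by grind)

lemma sim_of_long (hp : (0:ℤ) < p) (he : ∀ x, e (x + p) = e x) {c x y : ℤ} (hxy : x + p ≤ y)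
    (h : ∀ z, x < z → z ≤ y → c ≤ e z) (z : ℤ) : c ≤ e z := by
  have h1 := Int.emod_nonneg (z - x - 1) hp.ne'
  have h2 := Int.emod_lt_of_pos (z - x - 1) hp
  have h3 := Int.emod_add_mul_ediv (z - x - 1) p
  rw [← ed_per_mul he (-((z - x - 1) / p)) z]
  apply h <;> linarith

/-- The relation on `ℤ` determined by the heights. -/
def relOf (p k : ℕ) (e d : ℤ → ℤ) (x y : ℤ) : Prop := ∃ j : ℤ, sim e d x (y + j * (k * p))

lemma relOf_isT (hk : 4 ≤ k) (he : ∀ x, e (x + p) = e x) (hd : ∀ x, d (x + p) = d x)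
    (h1 : ∀ x, e x ≤ d x) : IsT p k (relOf p k e d) := by
  have hp : (0:ℤ) < p := by have := NeZero.pos p; exact_mod_cast this
  have hkp : 4 * (p:ℤ) ≤ k * p := by
    have : (4:ℤ) ≤ k := by exact_mod_cast hk
    nlinarith
  have hsN : ∀ j x y : ℤ, sim e d x y → sim e d (x + j * (k * p)) (y + j * (k * p)) := by
    intro j x y h
    have := sim_shift he hd (j * k) h
    simpa [mul_assoc] using this
  have heN : ∀ x : ℤ, e (x + k * p) = e x := fun x => ed_per_mul he _ _
  have hdN : ∀ x : ℤ, d (x + k * p) = d x := fun x => ed_per_mul hd _ _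
  have hrefl : ∀ x, sim e d x x := fun x => ⟨rfl, fun z a b => by simp at a b; lia⟩
  -- normal form
  have nf : ∀ x y : ℤ, x < y → y < x + k * p → relOf p k e d x y →
      sim e d x y ∨ sim e d y (x + k * p) := by
    rintro x y hx hy ⟨j, hj⟩
    rcases lt_trichotomy j 0 with hj0 | hj0 | hj0
    · by_cases hj1 : j = -1
      · right
        have := hsN 1 _ _ (sim_symm hj)
        subst hj1
        convert this using 1 <;> ring
      · left
        have hj2 : j * (k * p) ≤ -2 * (k * p) := by
          apply mul_le_mul_of_nonneg_right _ (by lia); lia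
        have := sim_of_long (c := d x) (x := y + j * (k * p)) (y := x) hp he (by linarith)
          (fun z a b => hj.2 z (by grind) (by grind))
        refine ⟨?_, fun z _ _ => this z⟩
        rw [hj.1]
        have := ed_per_mul hd (j * k) y
        rw [← this, mul_assoc]
    · left; subst hj0; simpa using hj
    · left
      have hj2 : 1 * (k * p) ≤ j * ((k:ℤ) * p) := by
          apply mul_le_mul_of_nonneg_right _ (by lia); lia
      have := sim_of_long (c := d x) (x := x) (y := y + j * (k * p)) hp he (by linarith)
          (fun z a b => hj.2 z (by grind) (by grind))
      refine ⟨?_, fun z _ _ => this z⟩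
      rw [hj.1]
      have := ed_per_mul hd (j * k) y
      rw [← this, mul_assoc]
  refine ⟨fun x => ⟨0, by simpa using hrefl x⟩, ?_, ?_, ?_, ?_, ?_⟩
  · rintro x y ⟨j, hj⟩
    have := hsN (-j) _ _ (sim_symm hj)
    exact ⟨-j, by convert this using 1; ring⟩
  · rintro x y z ⟨j, hj⟩ ⟨i, hi⟩
    have := hsN j _ _ hi
    exact ⟨j + i, by convert sim_trans hj this using 1; ring⟩
  · intro x; exact ⟨-1, by convert hrefl x using 1; ring⟩
  · intro x y
    constructor
    · rintro ⟨j, hj⟩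
      have := sim_shift he hd 1 hj
      exact ⟨j, by convert this using 1 <;> ring⟩
    · rintro ⟨j, hj⟩
      have := sim_shift he hd (-1) hj
      exact ⟨j, by convert this using 1 <;> ring⟩
  · intro x y z t xy yz zt tx hxz hyt
    have c1 := nf x z (by lia) (by lia) hxz
    have c2 := nf y t (by lia) (by lia) hyt
    have ey := heN y
    have ex := heN x
    have dy := hdN y
    have dx := hdN x
    rcases c1 with c1 | c1 <;> rcases c2 with c2 | c2
    · refine ⟨0, ?_⟩
      have a1 := c1.2 y (by grind) (by grind)
      have a2 := c2.2 z (by grind) (by grind)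
      have := h1 y; have := h1 z; have := c1.1; have := c2.1
      refine ⟨by simp; lia, fun u b1 b2 => c1.2 u (by grind) (by grind)⟩
    · refine ⟨0, ?_⟩
      have a1 := c1.2 y (by grind) (by grind)
      have a2 := c2.2 (x + k * p) (by grind) (by grind)
      have := h1 y; have := h1 x; have := c1.1; have := c2.1
      refine ⟨by simp; lia, fun u b1 b2 => c1.2 u (by grind) (by grind)⟩
    · refine ⟨-1, ?_⟩
      have a1 := c2.2 z (by grind) (by grind)
      have a2 := c1.2 t (by grind) (by grind)
      have := h1 z; have := h1 t; have := c1.1; have := c2.1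
      have hs : sim e d y (x + k * p) := by
        refine ⟨by lia, fun u b1 b2 => ?_⟩
        by_cases hu : u ≤ t
        · exact c2.2 u (by grind) (by grind)
        · have := c1.2 u (by grind) (by grind)
          lia
      have := hsN (-1) _ _ (sim_symm hs)
      convert this using 1; ring
    · refine ⟨0, ?_⟩
      have a1 := c1.2 t (by grind) (by grind)
      have a2 := c2.2 (x + k * p) (by grind) (by grind)
      have := h1 t; have := h1 x; have := c1.1; have := c2.1
      refine ⟨by simp; lia, fun u b1 b2 => ?_⟩
      have := c2.2 (u + k * p) (by grind) (by grind)
      rw [heN] at this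
      lia

lemma relOf_LL (hk : 4 ≤ k) (he : ∀ x, e (x + p) = e x) (hd : ∀ x, d (x + p) = d x)
    (h1 : ∀ x, e x ≤ d x) (h2 : ∀ x, e (x + 1) ≤ d x) (h3 : ∀ x, d x - 1 ≤ e x) (x : ℤ) :
    LL p (relOf p k e d) x ↔ e x < d x := by
  have hp : (0:ℤ) < p := by have := NeZero.pos p; exact_mod_cast this
  have hkp : 4 * (p:ℤ) ≤ k * p := by
    have : (4:ℤ) ≤ k := by exact_mod_cast hk
    nlinarith
  constructor
  · intro hL
    by_contra hc
    have hx : e x = d x := le_antisymm (h1 x) (by lia)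
    obtain ⟨y, ⟨hy1, hy2⟩, hy3⟩ := Int.exists_greatest_of_bdd (P := fun y => y < x ∧ d y ≤ d x)
      ⟨x, fun z hz => hz.1.le⟩ ⟨x - p, by lia, by have := hd (x - p); simp at this; lia⟩
    have hyp : x - p ≤ y := hy3 _ ⟨by lia, by have := hd (x - p); simp at this; lia⟩
    have hz : ∀ z, y < z → z ≤ x → d x ≤ e z := by
      intro z a b
      rcases b.lt_or_eq with b | b
      swap
      · rw [b]; lia
      have a1 := h3 z
      have a4 : ¬ (d z ≤ d x) := fun hh => by have := hy3 z ⟨b, hh⟩; lia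
      lia
    refine hL y hyp hy1 ⟨0, ?_⟩
    have := hz (y + 1) (by lia) (by lia)
    have := h2 y
    refine ⟨by simp; lia, fun z a b => ?_⟩
    have := hz z (by grind) (by grind)
    lia
  · rintro hlt y hy1 hy2 ⟨j, hj⟩
    have hdj : d (x + j * (k * p)) = d x := by
      have := ed_per_mul hd (j * k) x
      rw [← this, mul_assoc]
    have hej : e (x + j * (k * p)) = e x := by
      have := ed_per_mul he (j * k) x
      rw [← this, mul_assoc]
    have hdy := hj.1
    rcases le_or_gt 0 j with hj0 | hj0
    · have hj2 : 0 ≤ j * ((k:ℤ) * p) := mul_nonneg hj0 (by lia)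
      have := hj.2 (x + j * (k * p)) (by grind) (by grind)
      lia
    · have hj2 : j * (k * p) ≤ -1 * ((k:ℤ) * p) := by
        apply mul_le_mul_of_nonneg_right _ (by lia); lia
      have := sim_of_long (c := d y) (x := x + j * (k * p)) (y := y) hp he (by linarith)
          (fun z a b => hj.2 z (by grind) (by grind)) x
      lia

lemma relOf_RR (hk : 4 ≤ k) (he : ∀ x, e (x + p) = e x) (hd : ∀ x, d (x + p) = d x)
    (h1 : ∀ x, e x ≤ d x) (h2 : ∀ x, e (x + 1) ≤ d x) (h3 : ∀ x, d x - 1 ≤ e (x + 1)) (x : ℤ) :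
    RR p (relOf p k e d) x ↔ e (x + 1) < d x := by
  have hp : (0:ℤ) < p := by have := NeZero.pos p; exact_mod_cast this
  have hkp : 4 * (p:ℤ) ≤ k * p := by
    have : (4:ℤ) ≤ k := by exact_mod_cast hk
    nlinarith
  constructor
  · intro hL
    by_contra hc
    have hx : e (x + 1) = d x := le_antisymm (h2 x) (by lia)
    obtain ⟨y, ⟨hy1, hy2⟩, hy3⟩ := Int.exists_least_of_bdd (P := fun y => x < y ∧ d y ≤ d x)
      ⟨x, fun z hz => hz.1.le⟩ ⟨x + p, by lia, by have := hd x; lia⟩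
    have hyp : y ≤ x + p := hy3 _ ⟨by lia, by have := hd x; lia⟩
    have hz : ∀ z, x < z → z ≤ y → d x ≤ e z := by
      intro z a b
      by_cases hzx : z = x + 1
      · rw [hzx]; lia
      have a1 := h3 (z - 1)
      have a4 : ¬ (d (z - 1) ≤ d x) := fun hh => by have := hy3 (z - 1) ⟨by lia, hh⟩; lia
      simp at a1
      lia
    refine hL y hy1 hyp ⟨0, ?_⟩
    have := hz y (by lia) (by lia)
    have := h1 y
    refine ⟨by simp; lia, fun z a b => ?_⟩
    exact hz z (by grind) (by grind)
  · rintro hlt y hy1 hy2 ⟨j, hj⟩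
    rcases le_or_gt 0 j with hj0 | hj0
    · have hj2 : 0 ≤ j * ((k:ℤ) * p) := mul_nonneg hj0 (by lia)
      have := hj.2 (x + 1) (by grind) (by grind)
      lia
    · have hj2 : j * (k * p) ≤ -1 * ((k:ℤ) * p) := by
        apply mul_le_mul_of_nonneg_right _ (by lia); lia
      have := sim_of_long (c := d x) (x := y + j * (k * p)) (y := x) hp he (by linarith)
          (fun z a b => hj.2 z (by grind) (by grind)) (x + 1)
      lia

lemma exists_rel (hk : 4 ≤ k) (A B : Finset (ZMod p)) (hc : A.card = B.card) :
    ∃ E, IsT p k E ∧ LF p E = A ∧ RF p E = B := by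
  obtain ⟨e, he, hs⟩ := exists_e A B hc
  let d : ℤ → ℤ := fun x => e x + (if (x : ZMod p) ∈ A then 1 else 0)
  have hd : ∀ x, d (x + p) = d x := by intro x; simp [d, he]
  have h1 : ∀ x, e x ≤ d x := by intro x; simp only [d]; split_ifs <;> lia
  have h2 : ∀ x, e (x + 1) ≤ d x := by intro x; simp only [d, hs]; split_ifs <;> lia
  have h3 : ∀ x, d x - 1 ≤ e x := by intro x; simp only [d]; split_ifs <;> lia
  have h4 : ∀ x, d x - 1 ≤ e (x + 1) := by intro x; simp only [d, hs]; split_ifs <;> lia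
  have hT := relOf_isT (k := k) hk he hd h1
  refine ⟨_, hT, ?_, ?_⟩
  · ext a
    obtain ⟨x, rfl⟩ := ZMod.intCast_surjective a
    rw [mem_LF hT, relOf_LL hk he hd h1 h2 h3]
    simp only [d]; split_ifs <;> simp_all
  · ext a
    obtain ⟨x, rfl⟩ := ZMod.intCast_surjective a
    rw [mem_RF hT, relOf_RR hk he hd h1 h2 h4]
    simp only [d, hs]; split_ifs <;> simp_all

lemma card_pairs (p : ℕ) [NeZero p] :
    Nat.card {P : Finset (ZMod p) × Finset (ZMod p) // P.1.card = P.2.card} = (2 * p).choose p := by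
  have h0 : (2 * p).choose p = (Finset.powersetCard p (Finset.univ : Finset (ZMod p ⊕ ZMod p))).card := by
    rw [Finset.card_powersetCard]; simp [two_mul]
  rw [h0, ← Fintype.card_coe, ← Nat.card_eq_fintype_card]
  have hcard : ∀ B : Finset (ZMod p), B.card + Bᶜ.card = p := by
    intro B; have := Finset.card_add_card_compl B; simpa using this
  refine Nat.card_eq_of_bijective
    (fun P => ⟨Finset.disjSum P.1.1 P.1.2ᶜ, by
      simp only [Finset.mem_powersetCard, Finset.subset_univ, true_and, Finset.card_disjSum]
      have := hcard P.1.2; have := P.2; lia⟩) ⟨?_, ?_⟩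
  · rintro ⟨⟨A, B⟩, h⟩ ⟨⟨A', B'⟩, h'⟩ hh
    simp only [Subtype.mk.injEq] at hh
    have h1 := congrArg Finset.toLeft hh
    have h2 := congrArg Finset.toRight hh
    simp at h1 h2
    simp [h1, h2]
  · rintro ⟨S, hS⟩
    simp only [Finset.mem_powersetCard, Finset.subset_univ, true_and] at hS
    refine ⟨⟨(S.toLeft, S.toRightᶜ), ?_⟩, ?_⟩
    · have := hcard S.toRight
      have := Finset.card_toLeft_add_card_toRight (u := S)
      simp only; lia
    · simp only [Subtype.mk.injEq, compl_compl]
      exact Finset.toLeft_disjSum_toRight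

theorem card_T (p k : ℕ) [NeZero p] (hk : 4 ≤ k) :
    Nat.card {E : ℤ → ℤ → Prop // IsT p k E} = (2 * p).choose p := by
  rw [← card_pairs]
  refine Nat.card_eq_of_bijective (fun E => ⟨(LF p E.1, RF p E.1), card_LF_eq E.2⟩) ⟨?_, ?_⟩
  · rintro ⟨E, h⟩ ⟨E', h'⟩ hh
    simp only [Subtype.mk.injEq, Prod.mk.injEq] at hh
    ext x y
    exact ⟨E_imp h h' hk hh.1 hh.2 x y, E_imp h' h hk hh.1.symm hh.2.symm x y⟩
  · rintro ⟨⟨A, B⟩, hc⟩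
    obtain ⟨E, hE, rfl, rfl⟩ := exists_rel hk A B hc
    exact ⟨⟨E, hE⟩, rfl⟩
end



/-- label at position `x`. -/
def lab (m : ℕ) (x : ℤ) : ℤ :=
  if x % (2 * m) < m then x % (2 * m) + 1 else -(x % (2 * m) - m + 1)

section
variable {m : ℕ} (hm : 3 ≤ m)
include hm

lemma lab_bd (x : ℤ) : (1 ≤ lab m x ∧ lab m x ≤ m) ∨ (lab m x ≤ -1 ∧ -m ≤ lab m x) := by
  have h1 := Int.emod_nonneg x (b := 2 * m) (by lia)
  have h2 := Int.emod_lt_of_pos x (b := 2 * m) (by lia)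
  unfold lab; split_ifs <;> lia

lemma lab_abs (x : ℤ) : 1 ≤ |lab m x| ∧ |lab m x| ≤ m := by
  have := lab_bd hm x
  constructor
  · rw [le_abs]; lia
  · rw [abs_le]; lia

lemma lab_per (x j : ℤ) : lab m (x + j * (2 * m)) = lab m x := by
  unfold lab; simp

lemma lab_inj {x y : ℤ} (h : lab m x = lab m y) : ∃ j : ℤ, y = x + j * (2 * m) := by
  have h1 := Int.emod_nonneg x (b := 2 * m) (by lia)
  have h2 := Int.emod_lt_of_pos x (b := 2 * m) (by lia)
  have h3 := Int.emod_nonneg y (b := 2 * m) (by lia)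
  have h4 := Int.emod_lt_of_pos y (b := 2 * m) (by lia)
  have : x % (2 * m) = y % (2 * m) := by
    unfold lab at h; split_ifs at h <;> lia
  have e1 := Int.emod_add_mul_ediv x (2 * m)
  have e2 := Int.emod_add_mul_ediv y (2 * m)
  exact ⟨y / (2 * m) - x / (2 * m), by rw [this] at e1; linarith⟩

lemma lab_surj {a : ℤ} (h1 : 1 ≤ |a|) (h2 : |a| ≤ m) : ∃ x, lab m x = a := by
  rw [le_abs] at h1; rw [abs_le] at h2
  rcases h1 with h1 | h1
  · refine ⟨a - 1, ?_⟩
    unfold lab; rw [Int.emod_eq_of_lt (by lia) (by lia)]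
    split_ifs <;> lia
  · refine ⟨m - a - 1, ?_⟩
    unfold lab; rw [Int.emod_eq_of_lt (by lia) (by lia)]
    split_ifs <;> lia

lemma lab_red (x : ℤ) : ∃ y j : ℤ, 0 ≤ y ∧ y < 2 * m ∧ x = y + j * (2 * m) :=
  ⟨x % (2 * m), x / (2 * m), Int.emod_nonneg x (by lia), Int.emod_lt_of_pos x (by lia), by
    have := Int.emod_add_mul_ediv x (2 * m); linarith⟩

lemma lab_val1 {y : ℤ} (h0 : 0 ≤ y) (h1 : y < m) : lab m y = y + 1 := by
  unfold lab; rw [Int.emod_eq_of_lt (by lia) (by lia), if_pos h1]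

lemma lab_val2 {y : ℤ} (h0 : (m:ℤ) ≤ y) (h1 : y < 2 * m) : lab m y = -(y - m + 1) := by
  unfold lab; rw [Int.emod_eq_of_lt (by lia) (by lia), if_neg (by lia)]

lemma lab_add_m (x : ℤ) : lab m (x + m) = - lab m x := by
  obtain ⟨y, j, h0, h1, rfl⟩ := lab_red hm x
  rw [lab_per hm, show y + j * (2 * m) + m = (y + m) + j * (2 * m) by ring, lab_per hm]
  by_cases h : y < m
  · rw [lab_val1 hm h0 h, lab_val2 hm (by lia) (by lia)]; lia
  · have h2 : lab m (y + m) = lab m (y - m) := by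
      rw [← lab_per hm (y - m) 1]; congr 1; ring
    rw [h2, lab_val1 hm (by lia) (by lia), lab_val2 hm (by lia) (by lia)]; lia

lemma rho_lab (x : ℤ) : rhoFun (m + 1) (lab m x) = lab m (x + 1) := by
  obtain ⟨y, j, h0, h1, rfl⟩ := lab_red hm x
  rw [lab_per hm, show y + j * (2 * m) + 1 = (y + 1) + j * (2 * m) by ring, lab_per hm]
  unfold rhoFun
  by_cases h : y < m
  · rw [lab_val1 hm h0 h]
    by_cases h2 : y + 1 < m
    · rw [lab_val1 hm (by lia) h2]; push_cast; split_ifs <;> lia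
    · rw [lab_val2 hm (by lia) (by lia)]; push_cast; split_ifs <;> lia
  · rw [lab_val2 hm (by lia) h1]
    by_cases h2 : y + 1 < 2 * m
    · rw [lab_val2 hm (by lia) h2]; push_cast; split_ifs <;> lia
    · have h2 : lab m (y + 1) = lab m (y + 1 - 2 * m) := by
        rw [← lab_per hm (y + 1 - 2 * m) 1]; congr 1; ring
      rw [h2, lab_val1 hm (by lia) (by lia)]; push_cast; split_ifs <;> lia

lemma sigma_lab (x : ℤ) : sigmaFun (m + 1) (lab m x) = lab m x := by
  have := lab_bd hm x
  unfold sigmaFun; push_cast; split_ifs <;> lia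

lemma g_lab (s : ℕ) (x : ℤ) : (sigmaFun (m + 1) ∘ rhoFun (m + 1))^[s] (lab m x) = lab m (x + s) := by
  induction s generalizing x with
  | zero => simp
  | succ s ih =>
    rw [Function.iterate_succ_apply, Function.comp_apply, rho_lab hm, sigma_lab hm, ih]
    congr 1; push_cast; ring

lemma g_n (s : ℕ) : ((sigmaFun (m + 1) ∘ rhoFun (m + 1))^[s] ((m:ℤ) + 1) = m + 1 ∧
      (sigmaFun (m + 1) ∘ rhoFun (m + 1))^[s] (-((m:ℤ) + 1)) = -(m + 1)) ∨
    ((sigmaFun (m + 1) ∘ rhoFun (m + 1))^[s] ((m:ℤ) + 1) = -(m + 1) ∧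
      (sigmaFun (m + 1) ∘ rhoFun (m + 1))^[s] (-((m:ℤ) + 1)) = m + 1) := by
  induction s with
  | zero => simp
  | succ s ih =>
    have e1 : (sigmaFun (m + 1) ∘ rhoFun (m + 1)) ((m:ℤ) + 1) = -(m + 1) := by
      simp only [Function.comp_apply, rhoFun, sigmaFun]; push_cast; split_ifs <;> lia
    have e2 : (sigmaFun (m + 1) ∘ rhoFun (m + 1)) (-((m:ℤ) + 1)) = m + 1 := by
      simp only [Function.comp_apply, rhoFun, sigmaFun]; push_cast; split_ifs <;> lia
    rw [Function.iterate_succ_apply, Function.iterate_succ_apply, e1, e2]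
    tauto

omit hm in
/-- membership in the label set -/
lemma mem_signedSet (a : ℤ) : a ∈ signedSet (m + 1) ↔ (1 ≤ |a| ∧ |a| ≤ m) ∨ a = m + 1 ∨ a = -(m + 1) := by
  unfold signedSet
  rw [Set.mem_ofPred_eq]
  push_cast
  rcases abs_cases a with ⟨h, _⟩ | ⟨h, _⟩ <;> rw [h] <;> lia

lemma signed_cases {a : ℤ} (h : a ∈ signedSet (m + 1)) : (∃ x, a = lab m x) ∨ a = m + 1 ∨ a = -(m + 1) := by
  rcases (mem_signedSet a).1 h with h | h | h
  · obtain ⟨x, hx⟩ := lab_surj hm h.1 h.2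
    exact Or.inl ⟨x, hx.symm⟩
  · tauto
  · tauto

lemma lab_mem (x : ℤ) : lab m x ∈ signedSet (m + 1) := (mem_signedSet _).2 (Or.inl (lab_abs hm x))

lemma lab_ne_n (x : ℤ) : lab m x ≠ m + 1 := by have := lab_bd hm x; lia
lemma lab_ne_n' (x : ℤ) : lab m x ≠ -(m + 1) := by have := lab_bd hm x; lia

end



/-- orientation determinant, positive for clockwise triples. -/
def dd (a b c : ℝ × ℝ) : ℝ := (b.2 - a.2) * (c.1 - a.1) - (b.1 - a.1) * (c.2 - a.2)

lemma mem_hull3 {S : Set (ℝ × ℝ)} {x v z u : ℝ × ℝ} (hx : x ∈ S) (hv : v ∈ S) (hz : z ∈ S)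
    {α β γ : ℝ} (ha : 0 ≤ α) (hb : 0 ≤ β) (hc : 0 ≤ γ) (h1 : α + β + γ = 1)
    (hu : u = α • x + β • v + γ • z) : u ∈ convexHull ℝ S := by
  have key := (convex_convexHull ℝ S).sum_mem (t := (Finset.univ : Finset (Fin 3)))
    (w := ![α, β, γ]) (z := ![x, v, z])
    (by intro i _; fin_cases i <;> simpa) (by simp [Fin.sum_univ_three, h1])
    (by
      intro i _
      apply subset_convexHull ℝ S
      fin_cases i
      · exact hx
      · exact hv
      · exact hz)
  rw [hu]
  simpa [Fin.sum_univ_three] using key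

lemma tri_interior {S : Set (ℝ × ℝ)} {x v z u : ℝ × ℝ} (hx : x ∈ S) (hv : v ∈ S) (hz : z ∈ S)
    (h1 : 0 < dd x v u) (h2 : 0 < dd v z u) (h3 : 0 < dd z x u) : u ∈ interior (convexHull ℝ S) := by
  rw [mem_interior]
  refine ⟨{u | 0 < dd x v u ∧ 0 < dd v z u ∧ 0 < dd z x u}, ?_, ?_, h1, h2, h3⟩
  · rintro w ⟨g1, g2, g3⟩
    have hs : dd x v w + dd v z w + dd z x w = dd x v z := by unfold dd; ring
    have hpos : 0 < dd x v z := by linarith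
    refine mem_hull3 hx hv hz (α := dd v z w / dd x v z) (β := dd z x w / dd x v z)
      (γ := dd x v w / dd x v z) (by positivity) (by positivity) (by positivity) ?_ ?_
    · field_simp; linarith
    · ext
      · simp only [Prod.fst_add, Prod.smul_fst, smul_eq_mul]
        field_simp; unfold dd; ring
      · simp only [Prod.snd_add, Prod.smul_snd, smul_eq_mul]
        field_simp; unfold dd; ring
  · have c : ∀ a b : ℝ × ℝ, Continuous (fun u => dd a b u) := by
      intro a b; unfold dd; fun_prop
    exact (isOpen_lt continuous_const (c x v)).inter
      ((isOpen_lt continuous_const (c v z)).inter (isOpen_lt continuous_const (c z x)))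

lemma quad_interior {S : Set (ℝ × ℝ)} {a b : ℝ × ℝ} (ha : a ∈ S) (ha' : -a ∈ S) (hb : b ∈ S) (hb' : -b ∈ S)
    (hD : a.1 * b.2 - a.2 * b.1 ≠ 0) : (0, 0) ∈ interior (convexHull ℝ S) := by
  set D := a.1 * b.2 - a.2 * b.1 with hDdef
  rw [mem_interior]
  refine ⟨{u | |(u.1 * b.2 - u.2 * b.1) / D| + |(a.1 * u.2 - a.2 * u.1) / D| < 1}, ?_, ?_, by simp⟩
  · intro u hu
    rw [Set.mem_ofPred_eq] at hu
    set α := (u.1 * b.2 - u.2 * b.1) / D with hα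
    set β := (a.1 * u.2 - a.2 * u.1) / D with hβ
    have hu' : u = α • a + β • b := by
      ext
      · simp only [Prod.fst_add, Prod.smul_fst, smul_eq_mul, hα, hβ]; field_simp; rw [hDdef]; ring
      · simp only [Prod.snd_add, Prod.smul_snd, smul_eq_mul, hα, hβ]; field_simp; rw [hDdef]; ring
    -- signs
    obtain ⟨a', ma, ma', ea⟩ : ∃ a' : ℝ × ℝ, a' ∈ S ∧ -a' ∈ S ∧ α • a = |α| • a' := by
      rcases abs_cases α with ⟨h, _⟩ | ⟨h, _⟩
      · exact ⟨a, ha, ha', by rw [h]⟩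
      · exact ⟨-a, ha', by simpa, by rw [h]; simp⟩
    obtain ⟨b', mb, mb', eb⟩ : ∃ b' : ℝ × ℝ, b' ∈ S ∧ -b' ∈ S ∧ β • b = |β| • b' := by
      rcases abs_cases β with ⟨h, _⟩ | ⟨h, _⟩
      · exact ⟨b, hb, hb', by rw [h]⟩
      · exact ⟨-b, hb', by simpa, by rw [h]; simp⟩
    have hA := abs_nonneg α
    have hB := abs_nonneg β
    refine mem_hull3 ma mb ma' (α := |α| + (1 - |α| - |β|) / 2) (β := |β|) (γ := (1 - |α| - |β|) / 2)
      (by linarith) hB (by linarith) (by ring) ?_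
    rw [hu', ea, eb]; module
  · exact isOpen_lt (by fun_prop) continuous_const

lemma cross_aux {S S' : Set (ℝ × ℝ)} {x y z t v : ℝ × ℝ} (hx : x ∈ S) (hz : z ∈ S) (hv : v ∈ S)
    (hy : y ∈ S') (ht : t ∈ S')
    (h1 : 0 < dd x y z) (h2 : 0 < dd y z t) (h3 : 0 < dd x z t) (h4 : 0 < dd x y t)
    (hxv : 0 < dd x v z) :
    ∃ u ∈ convexHull ℝ S', u ∈ intrinsicInterior ℝ (convexHull ℝ S) := by
  have hs : dd x y z + dd x z t = dd x y t + dd y z t := by unfold dd; ring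
  set s := dd x y z + dd x z t with hsdef
  have hs0 : 0 < s := by linarith
  let q : ℝ × ℝ := (dd x z t / s) • y + (dd x y z / s) • t
  have hq : q = (dd y z t / s) • x + (dd x y t / s) • z := by
    ext
    · simp only [q, Prod.fst_add, Prod.smul_fst, smul_eq_mul]
      field_simp; unfold dd; ring
    · simp only [q, Prod.snd_add, Prod.smul_snd, smul_eq_mul]
      field_simp; unfold dd; ring
  have lin : ∀ a b c d : ℝ × ℝ, ∀ α β : ℝ, α + β = 1 → dd a b (α • c + β • d) = α * dd a b c + β * dd a b d := by
    intro a b c d α β h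
    obtain rfl : β = 1 - α := by linarith
    unfold dd
    simp only [Prod.fst_add, Prod.smul_fst, smul_eq_mul, Prod.snd_add, Prod.smul_snd]
    ring
  have hw : dd y z t / s + dd x y t / s = 1 := by rw [← add_div, add_comm, ← hs]; exact div_self hs0.ne'
  have q1 : 0 < dd x v q := by
    rw [hq, lin _ _ _ _ _ _ hw, show dd x v x = 0 by unfold dd; ring, mul_zero, zero_add]
    positivity
  have q2 : 0 < dd v z q := by
    rw [hq, lin _ _ _ _ _ _ hw, show dd v z z = 0 by unfold dd; ring, mul_zero, add_zero,
      show dd v z x = dd x v z by unfold dd; ring]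
    positivity
  have q3 : dd z x q = 0 := by
    rw [hq, lin _ _ _ _ _ _ hw, show dd z x z = 0 by unfold dd; ring, show dd z x x = 0 by unfold dd; ring]
    ring
  have c : ∀ a b : ℝ × ℝ, Continuous (fun ε : ℝ => dd a b ((1 - ε) • q + ε • y)) := by
    intro a b
    unfold dd
    fun_prop
  have ev1 : ∀ᶠ ε in nhdsWithin (0:ℝ) (Set.Ioi 0), 0 < dd x v ((1 - ε) • q + ε • y) := by
    apply nhdsWithin_le_nhds
    exact (c x v).continuousAt.eventually (lt_mem_nhds (by simpa using q1))
  have ev2 : ∀ᶠ ε in nhdsWithin (0:ℝ) (Set.Ioi 0), 0 < dd v z ((1 - ε) • q + ε • y) := by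
    apply nhdsWithin_le_nhds
    exact (c v z).continuousAt.eventually (lt_mem_nhds (by simpa using q2))
  have ev3 : ∀ᶠ ε in nhdsWithin (0:ℝ) (Set.Ioi 0), ε ∈ Set.Ioo (0:ℝ) 1 :=
    Ioo_mem_nhdsGT one_pos
  obtain ⟨ε, ⟨e1, e2⟩, e3, e4⟩ := (ev1.and ev2).and ev3 |>.exists
  refine ⟨(1 - ε) • q + ε • y, ?_, ?_⟩
  · have hqm : q ∈ convexHull ℝ S' :=
      (convex_convexHull ℝ S') (subset_convexHull ℝ S' hy) (subset_convexHull ℝ S' ht) (by positivity)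
        (by positivity) (by rw [← add_div, add_comm]; exact div_self hs0.ne')
    exact (convex_convexHull ℝ S') hqm (subset_convexHull ℝ S' hy) (by linarith) e3.le (by ring)
  · apply interior_subset_intrinsicInterior
    refine tri_interior hx hv hz e1 e2 ?_
    rw [lin _ _ _ _ _ _ (by ring), q3, show dd z x y = dd x y z by unfold dd; ring]
    have : 0 < ε * dd x y z := mul_pos e3 h1
    linarith

lemma line_param {x z v : ℝ × ℝ} (hne : x ≠ z) (h : dd x z v = 0) :
    v = x + (((v.1 - x.1) * (z.1 - x.1) + (v.2 - x.2) * (z.2 - x.2)) /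
      ((z.1 - x.1) ^ 2 + (z.2 - x.2) ^ 2)) • (z - x) := by
  have hpos : 0 < (z.1 - x.1) ^ 2 + (z.2 - x.2) ^ 2 := by
    by_contra hc
    apply hne
    have e1 : z.1 - x.1 = 0 := by nlinarith [sq_nonneg (z.1 - x.1), sq_nonneg (z.2 - x.2)]
    have e2 : z.2 - x.2 = 0 := by nlinarith [sq_nonneg (z.1 - x.1), sq_nonneg (z.2 - x.2)]
    ext <;> linarith
  unfold dd at h
  ext
  · simp only [Prod.fst_add, Prod.smul_fst, smul_eq_mul, Prod.fst_sub]
    field_simp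
    linear_combination (z.2 - x.2) * h
  · simp only [Prod.snd_add, Prod.smul_snd, smul_eq_mul, Prod.snd_sub]
    field_simp
    linear_combination -(z.1 - x.1) * h

lemma cross_line {S : Set (ℝ × ℝ)} {x z q : ℝ × ℝ} (hx : x ∈ S) (hz : z ∈ S) (hne : x ≠ z)
    (hS : ∀ v ∈ S, dd x z v = 0) (α : ℝ) (h0 : 0 < α) (h1 : α < 1) (hq : q = x + α • (z - x)) :
    q ∈ intrinsicInterior ℝ (convexHull ℝ S) := by
  have hpos : 0 < (z.1 - x.1) ^ 2 + (z.2 - x.2) ^ 2 := by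
    by_contra hc
    apply hne
    have e1 : z.1 - x.1 = 0 := by nlinarith [sq_nonneg (z.1 - x.1), sq_nonneg (z.2 - x.2)]
    have e2 : z.2 - x.2 = 0 := by nlinarith [sq_nonneg (z.1 - x.1), sq_nonneg (z.2 - x.2)]
    ext <;> linarith
  have hseg : ∀ β : ℝ, 0 ≤ β → β ≤ 1 → x + β • (z - x) ∈ convexHull ℝ S := by
    intro β b0 b1
    have := (convex_convexHull ℝ S) (subset_convexHull ℝ S hx) (subset_convexHull ℝ S hz)
      (show 0 ≤ 1 - β by linarith) b0 (by ring)
    convert this using 1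
    module
  have hspan : ∀ v ∈ affineSpan ℝ (convexHull ℝ S), dd x z v = 0 := by
    intro v hv
    rw [affineSpan_convexHull] at hv
    have hle : affineSpan ℝ S ≤ line[ℝ, x, z] := by
      rw [affineSpan_le]
      intro v hv
      rw [line_param hne (hS v hv)]
      have := AffineMap.lineMap_mem_affineSpan_pair (k := ℝ) (((v.1 - x.1) * (z.1 - x.1) + (v.2 - x.2) * (z.2 - x.2)) /
        ((z.1 - x.1) ^ 2 + (z.2 - x.2) ^ 2)) x z
      rw [AffineMap.lineMap_apply_module', add_comm] at this
      exact this
    obtain ⟨r, rfl⟩ := (mem_affineSpan_pair_iff_exists_lineMap_eq).1 (hle hv)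
    rw [AffineMap.lineMap_apply_module']
    unfold dd
    simp only [Prod.fst_add, Prod.smul_fst, smul_eq_mul, Prod.snd_add, Prod.smul_snd, Prod.fst_sub, Prod.snd_sub]
    ring
  have hqm : q ∈ convexHull ℝ S := by rw [hq]; exact hseg α h0.le h1.le
  rw [mem_intrinsicInterior]
  refine ⟨⟨q, subset_affineSpan ℝ _ hqm⟩, ?_, rfl⟩
  let τ : ℝ × ℝ → ℝ := fun v => ((v.1 - x.1) * (z.1 - x.1) + (v.2 - x.2) * (z.2 - x.2)) /
      ((z.1 - x.1) ^ 2 + (z.2 - x.2) ^ 2)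
  have hτ : Continuous τ := by fun_prop
  have hτq : τ q = α := by
    simp only [τ, hq, Prod.fst_add, Prod.smul_fst, smul_eq_mul, Prod.snd_add, Prod.smul_snd, Prod.fst_sub, Prod.snd_sub]
    field_simp; ring
  rw [mem_interior]
  refine ⟨{u | 0 < τ u.1 ∧ τ u.1 < 1}, ?_, ?_, ?_⟩
  · rintro ⟨u, hu⟩ ⟨g1, g2⟩
    have := hseg (τ u) g1.le g2.le
    rw [Set.mem_preimage]
    rwa [← line_param hne (hspan u hu)] at this
  · exact (isOpen_lt continuous_const (hτ.comp continuous_subtype_val)).inter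
      (isOpen_lt (hτ.comp continuous_subtype_val) continuous_const)
  · simp only [Set.mem_ofPred_eq, hτq]; exact ⟨h0, h1⟩

lemma cross_pts {S S' : Set (ℝ × ℝ)} {x y z t : ℝ × ℝ} (hx : x ∈ S) (hz : z ∈ S)
    (hy : y ∈ S') (ht : t ∈ S')
    (h1 : 0 < dd x y z) (h2 : 0 < dd y z t) (h3 : 0 < dd x z t) (h4 : 0 < dd x y t) :
    ∃ u ∈ convexHull ℝ S', u ∈ intrinsicInterior ℝ (convexHull ℝ S) := by
  by_cases hS : ∀ v ∈ S, dd x z v = 0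
  · have hs : dd x y z + dd x z t = dd x y t + dd y z t := by unfold dd; ring
    set s := dd x y z + dd x z t with hsdef
    have hs0 : 0 < s := by linarith
    have hne : x ≠ z := by
      rintro rfl
      rw [show dd x y x = 0 by unfold dd; ring] at h1
      exact lt_irrefl _ h1
    refine ⟨(dd x z t / s) • y + (dd x y z / s) • t, ?_, ?_⟩
    · exact (convex_convexHull ℝ S') (subset_convexHull ℝ S' hy) (subset_convexHull ℝ S' ht) (by positivity)
        (by positivity) (by rw [← add_div, add_comm]; exact div_self hs0.ne')
    · refine cross_line hx hz hne hS (dd x y t / s) (by positivity) ?_ ?_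
      · rw [div_lt_one hs0]; linarith
      · ext
        · simp only [Prod.fst_add, Prod.smul_fst, smul_eq_mul, Prod.fst_sub]
          field_simp; rw [hsdef]; unfold dd; ring
        · simp only [Prod.snd_add, Prod.smul_snd, smul_eq_mul, Prod.snd_sub]
          field_simp; rw [hsdef]; unfold dd; ring
  · push Not at hS
    obtain ⟨v, hv, hne⟩ := hS
    have cyc : ∀ a b c, dd a b c = dd b c a := by intro a b c; unfold dd; ring
    rcases hne.lt_or_gt with hlt | hgt
    · refine cross_aux hx hz hv hy ht h1 h2 h3 h4 ?_
      have : dd x v z = - dd x z v := by unfold dd; ring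
      linarith
    · refine cross_aux hz hx hv ht hy (x := z) (y := t) (z := x) (t := y) ?_ ?_ ?_ ?_ ?_
      · rw [cyc, cyc]; exact h3
      · rw [cyc]; exact h4
      · rw [cyc]; exact h1
      · rw [cyc, cyc]; exact h2
      · rw [cyc, cyc]; exact hgt



/-- the point of the circle at clockwise position `θ`. -/
noncomputable def Pc (m : ℕ) (θ : ℝ) : ℝ × ℝ := (Real.cos (Real.pi * θ / m), -Real.sin (Real.pi * θ / m))

/-- dot product. -/
def dt (u v : ℝ × ℝ) : ℝ := u.1 * v.1 + u.2 * v.2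

lemma hull_lt {n : ℕ} {B : Set ℤ} {v : ℝ × ℝ} {c : ℝ} (h : ∀ b ∈ B, dt v (pt n b) < c) :
    ∀ u ∈ hullOf n B, dt v u < c := by
  have hc : Convex ℝ {u : ℝ × ℝ | dt v u < c} := by
    intro x hx y hy a b ha hb hab
    simp only [Set.mem_ofPred_eq] at *
    have e : dt v (a • x + b • y) = a * dt v x + b * dt v y := by
      simp [dt]; ring
    rw [e]
    rcases ha.eq_or_lt with rfl | ha
    · have : b = 1 := by linarith
      subst this; linarith
    · obtain rfl : b = 1 - a := by linarith
      nlinarith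
  intro u hu
  refine convexHull_min ?_ hc hu
  rintro _ ⟨b, hb, rfl⟩
  exact h b hb

lemma hull_gt {n : ℕ} {B : Set ℤ} {v : ℝ × ℝ} {c : ℝ} (h : ∀ b ∈ B, c < dt v (pt n b)) :
    ∀ u ∈ hullOf n B, c < dt v u := by
  intro u hu
  have := hull_lt (n := n) (B := B) (v := -v) (c := -c) (by
    intro b hb
    have := h b hb
    simp only [dt, Prod.fst_neg, Prod.snd_neg] at *
    linarith) u hu
  simp only [dt, Prod.fst_neg, Prod.snd_neg] at *
  linarith

section
variable {m : ℕ} (hm : 3 ≤ m)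
include hm

lemma dt_Pc (a b : ℝ) : dt (Pc m a) (Pc m b) = Real.cos (Real.pi * (a - b) / m) := by
  rw [show Real.pi * (a - b) / m = Real.pi * a / m - Real.pi * b / m by ring, Real.cos_sub]
  simp [dt, Pc]

lemma Pc_per (a : ℝ) (j : ℤ) : Pc m (a + j * (2 * m)) = Pc m a := by
  have hm' : (m : ℝ) ≠ 0 := by positivity
  unfold Pc
  rw [show Real.pi * (a + j * (2 * m)) / m = Real.pi * a / m + j * (2 * Real.pi) by field_simp,
    Real.cos_add_int_mul_two_pi, Real.sin_add_int_mul_two_pi]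

lemma Pc_add_m (a : ℝ) : Pc m (a + m) = - Pc m a := by
  have hm' : (m : ℝ) ≠ 0 := by positivity
  unfold Pc
  rw [show Real.pi * (a + m) / m = Real.pi * a / m + Real.pi by field_simp,
    Real.cos_add_pi, Real.sin_add_pi]
  simp

lemma pt_lab (x : ℤ) : pt (m + 1) (lab m x) = Pc m x := by
  have hm' : (m : ℝ) ≠ 0 := by positivity
  obtain ⟨y, j, h0, h1, rfl⟩ := lab_red hm x
  rw [lab_per hm]
  push_cast
  rw [Pc_per hm]
  have hb := lab_abs hm y
  unfold pt
  rw [if_neg (by push_cast; lia)]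
  have hp : posR (m + 1) (lab m y) = y := by
    unfold posR
    by_cases h : y < m
    · rw [lab_val1 hm h0 h, if_pos (by lia)]; push_cast; ring
    · rw [lab_val2 hm (by lia) h1, if_neg (by lia)]; push_cast; ring
  rw [hp, Real.cos_neg, Real.sin_neg]
  unfold Pc
  rw [show 2 * Real.pi * (y : ℝ) / (2 * ((m + 1 : ℕ) : ℝ) - 2) = Real.pi * y / m by
    push_cast; rw [show 2 * ((m:ℝ) + 1) - 2 = 2 * m by ring]; field_simp]

omit hm in
lemma pt_n {i : ℤ} (h : |i| = m + 1) : pt (m + 1) i = (0, 0) := by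
  unfold pt; rw [if_pos (by push_cast; exact h)]

lemma dd_pos {a b c : ℝ} (h1 : a < b) (h2 : b < c) (h3 : c < a + 2 * m) :
    0 < dd (Pc m a) (Pc m b) (Pc m c) := by
  have hm' : (0 : ℝ) < m := by positivity
  set u := Real.pi * (b - a) / (2 * m) with hu
  set v := Real.pi * (c - b) / (2 * m) with hv
  have pp := Real.pi_pos
  have u0 : 0 < u := by rw [hu]; apply div_pos <;> [apply mul_pos; skip] <;> linarith
  have v0 : 0 < v := by rw [hv]; apply div_pos <;> [apply mul_pos; skip] <;> linarith
  have uv : u + v < Real.pi := by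
    rw [hu, hv, ← add_div, div_lt_iff₀ (by linarith)]; nlinarith
  have key : dd (Pc m a) (Pc m b) (Pc m c) = 4 * Real.sin u * Real.sin v * Real.sin (u + v) := by
    have eb : Real.pi * b / m = Real.pi * a / m + 2 * u := by rw [hu]; field_simp; ring
    have ec : Real.pi * c / m = Real.pi * a / m + 2 * (u + v) := by rw [hu, hv]; field_simp; ring
    have e1 : dd (Pc m a) (Pc m b) (Pc m c) =
        Real.sin (Real.pi * b / m - Real.pi * a / m) + Real.sin (Real.pi * c / m - Real.pi * b / m)
          - Real.sin (Real.pi * c / m - Real.pi * a / m) := by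
      rw [Real.sin_sub, Real.sin_sub, Real.sin_sub]; unfold dd Pc; simp only; ring
    rw [e1, eb, ec]
    rw [show Real.pi * a / m + 2 * u - Real.pi * a / m = 2 * u by ring,
      show Real.pi * a / m + 2 * (u + v) - (Real.pi * a / m + 2 * u) = 2 * v by ring,
      show Real.pi * a / m + 2 * (u + v) - Real.pi * a / m = 2 * (u + v) by ring,
      Real.sin_two_mul, Real.sin_two_mul, Real.sin_two_mul, Real.sin_add, Real.cos_add]
    have cu := Real.sin_sq_add_cos_sq u
    have cv := Real.sin_sq_add_cos_sq v
    linear_combination (-2 * Real.sin v * Real.cos v) * cu + (-2 * Real.sin u * Real.cos u) * cv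
  rw [key]
  have s1 := Real.sin_pos_of_pos_of_lt_pi u0 (by linarith)
  have s2 := Real.sin_pos_of_pos_of_lt_pi v0 (by linarith)
  have s3 := Real.sin_pos_of_pos_of_lt_pi (show 0 < u + v by linarith) uv
  positivity

lemma mem_of_mem_hull {B : Set ℤ} (hB : B ⊆ signedSet (m + 1)) {x : ℤ}
    (h : Pc m x ∈ hullOf (m + 1) B) : lab m x ∈ B := by
  have hm' : (m : ℝ) ≠ 0 := by positivity
  by_contra hc
  have self : dt (Pc m x) (Pc m x) = 1 := by rw [dt_Pc hm]; simp
  have := hull_lt (v := Pc m x) (c := 1) (n := m + 1) (B := B) (by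
    intro b hb
    rcases signed_cases hm (hB hb) with ⟨y, rfl⟩ | rfl | rfl
    · rw [pt_lab hm, dt_Pc hm]
      apply lt_of_le_of_ne (Real.cos_le_one _)
      intro h1
      obtain ⟨k, hk⟩ := (Real.cos_eq_one_iff _).1 h1
      apply hc
      have pp := Real.pi_pos.ne'
      have : (x : ℝ) = y + k * (2 * m) := by
        field_simp at hk
        linarith
      have : x = y + k * (2 * m) := by exact_mod_cast this
      rw [this, lab_per hm]; exact hb
    · rw [pt_n (by rw [abs_of_nonneg (by lia)])]; simp [dt]
    · rw [pt_n (by rw [abs_neg, abs_of_nonneg (by lia)])]; simp [dt]) _ h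
  linarith

lemma mem_hull {B : Set ℤ} {x : ℤ} (h : lab m x ∈ B) : Pc m x ∈ hullOf (m + 1) B := by
  rw [← pt_lab hm]; exact subset_convexHull ℝ _ (Set.mem_image_of_mem _ h)

lemma crosses_of {B B' : Set ℤ} (hB : B ⊆ signedSet (m + 1)) (hB' : B' ⊆ signedSet (m + 1))
    (hd : ∀ x, lab m x ∈ B → lab m x ∉ B') {x y z t : ℤ} (h1 : x < y) (h2 : y < z) (h3 : z < t)
    (h4 : t < x + 2 * m) (hx : lab m x ∈ B) (hz : lab m z ∈ B) (hy : lab m y ∈ B') (ht : lab m t ∈ B') :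
    Crosses (m + 1) B B' := by
  constructor
  · intro he
    have := mem_hull hm hx
    rw [he] at this
    exact hd x hx (mem_of_mem_hull hm hB' this)
  · left
    have r1 : (x:ℝ) < y := by exact_mod_cast h1
    have r2 : (y:ℝ) < z := by exact_mod_cast h2
    have r3 : (z:ℝ) < t := by exact_mod_cast h3
    have r4 : (t:ℝ) < x + 2 * m := by exact_mod_cast h4
    have mm : ∀ {w : ℤ} {B : Set ℤ}, lab m w ∈ B → Pc m w ∈ pt (m + 1) '' B := by
      intro w B h
      rw [← pt_lab hm]; exact Set.mem_image_of_mem _ h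
    exact cross_pts (mm hx) (mm hz) (mm hy) (mm ht) (dd_pos hm r1 r2 (by linarith))
      (dd_pos hm r2 r3 (by linarith)) (dd_pos hm (by linarith) r3 r4) (dd_pos hm r1 (by linarith) r4)

end



lemma shift_into {N : ℤ} (hN : 0 < N) (a x : ℤ) : ∃ j : ℤ, a ≤ x + j * N ∧ x + j * N < a + N := by
  refine ⟨-((x - a) / N), ?_⟩
  have h1 := Int.emod_nonneg (x - a) (b := N) (by lia)
  have h2 := Int.emod_lt_of_pos (x - a) (b := N) hN
  have h3 := Int.emod_add_mul_ediv (x - a) N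
  constructor <;> nlinarith

section
variable {m p k : ℕ} (hm : 3 ≤ m)
include hm

lemma cos_lt_aux {t0 t : ℝ} (h0 : 0 ≤ t0) (h1 : t0 < t) (h2 : t < 2 * m - t0) :
    Real.cos (Real.pi * t / m) < Real.cos (Real.pi * t0 / m) := by
  have hm' : (0 : ℝ) < m := by positivity
  have pp := Real.pi_pos
  have h00 : 0 ≤ Real.pi * t0 / m := by positivity
  by_cases h : t ≤ m
  · apply Real.cos_lt_cos_of_nonneg_of_le_pi h00
    · rw [div_le_iff₀ hm']; nlinarith
    · gcongr
  · push Not at h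
    rw [← Real.cos_two_pi_sub (Real.pi * t / m)]
    have e : 2 * Real.pi - Real.pi * t / m = Real.pi * (2 * m - t) / m := by field_simp
    rw [e]
    apply Real.cos_lt_cos_of_nonneg_of_le_pi h00
    · rw [div_le_iff₀ hm']; nlinarith
    · gcongr; linarith

lemma cos_gt_aux {t0 t : ℝ} (h0 : -t0 < t) (h1 : t < t0) (h2 : t0 ≤ m) :
    Real.cos (Real.pi * t0 / m) < Real.cos (Real.pi * t / m) := by
  have hm' : (0 : ℝ) < m := by positivity
  have pp := Real.pi_pos
  wlog h : 0 ≤ t generalizing t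
  · have := this (t := -t) (by linarith) (by linarith) (by linarith)
    rwa [mul_neg, neg_div, Real.cos_neg] at this
  apply Real.cos_lt_cos_of_nonneg_of_le_pi (by positivity)
  · rw [div_le_iff₀ hm']; nlinarith
  · gcongr

variable (hp : 0 < p) (hpm : p ∣ m) (hlt : p < m) (hk : k * p = 2 * m)
  {E : ℤ → ℤ → Prop} (h : IsT p k E)
include hp hpm hlt hk h

omit hm hp hpm hlt in
lemma per2 (x j : ℤ) : E x (x + j * (2 * m)) := by
  have e : ((k : ℤ) * p) = 2 * m := by exact_mod_cast hk
  have := h.per_mul j x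
  rwa [e] at this

omit hm hp hpm hlt in
lemma nc2 (x y z t : ℤ) (h1 : x < y) (h2 : y < z) (h3 : z < t) (h4 : t < x + 2 * m) (e1 : E x z)
    (e2 : E y t) : E x y := by
  have e : ((k : ℤ) * p) = 2 * m := by exact_mod_cast hk
  exact h.nc x y z t h1 h2 h3 (by rw [e]; exact h4) e1 e2

omit hm hp hlt hk in
lemma inv_m (x y : ℤ) : E x y ↔ E (x + m) (y + m) := by
  obtain ⟨c, rfl⟩ := hpm
  have := h.inv_mul c x y
  push_cast
  rwa [mul_comm (p : ℤ) c]

omit hm hp hlt hk in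
lemma m_of_cen {x : ℤ} (hx : E x (x + p)) : E x (x + m) := by
  obtain ⟨c, rfl⟩ := hpm
  have := h.cen_mul hx c
  push_cast
  rwa [mul_comm (p : ℤ) c]

omit hm hpm in
lemma cen_of_m {x : ℤ} (hx : E x (x + m)) : E x (x + p) := by
  have h2 := (h.inv x (x + m)).1 hx
  exact nc2 hk h x (x + p) (x + m) (x + m + p) (by lia) (by lia) (by lia) (by lia) hx h2

omit hm hp hpm hlt hk in
lemma cen_congr {x y : ℤ} (hxy : E x y) (hx : E x (x + p)) : E y (y + p) :=
  h.trans _ _ _ (h.symm _ _ hxy) (h.trans _ _ _ hx ((h.inv x y).1 hxy))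

omit hm hpm in
lemma cen_unique {x y : ℤ} (hx : E x (x + p)) (hy : E y (y + p)) : E x y := by
  obtain ⟨j, h1, h2⟩ := shift_into (N := p) (by lia) x y
  have e1 := h.cen_mul hy j
  have e2 := cen_congr h e1 hy
  set y' := y + j * p
  refine h.trans _ _ _ ?_ (h.symm _ _ e1)
  rcases h1.eq_or_lt with h1 | h1
  · rw [← h1]; exact h.refl x
  · exact nc2 hk h x y' (x + p) (y' + p) h1 h2 (by lia) (by lia) hx e2

omit hp hpm hlt in
lemma sep {x y : ℤ} (hxy : ¬ E x y) : ∃ v : ℝ × ℝ, ∃ c : ℝ, (∀ z : ℤ, E x z → dt v (Pc m z) < c) ∧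
    (∀ z : ℤ, E y z → c < dt v (Pc m z)) := by
  have hN : (0 : ℤ) < 2 * m := by lia
  obtain ⟨a, ⟨ha1, ha2⟩, ha3⟩ := Int.exists_greatest_of_bdd (P := fun z => E x z ∧ z < y)
    ⟨y, fun z hz => hz.2.le⟩ (by
      obtain ⟨j, _, h2⟩ := shift_into hN (y - 2 * m) x
      exact ⟨x + j * (2 * m), per2 hk h x j, by linarith⟩)
  obtain ⟨b, ⟨hb1, hb2⟩, hb3⟩ := Int.exists_least_of_bdd (P := fun z => E x z ∧ y < z)
    ⟨y, fun z hz => hz.2.le⟩ (by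
      obtain ⟨j, h2, _⟩ := shift_into hN (y + 1) x
      exact ⟨x + j * (2 * m), per2 hk h x j, by linarith⟩)
  have key : ∀ z, E x z → z ≤ a ∨ b ≤ z := by
    intro z hz
    rcases lt_trichotomy z y with h1 | h1 | h1
    · exact Or.inl (ha3 z ⟨hz, h1⟩)
    · exact absurd (h1 ▸ hz) hxy
    · exact Or.inr (hb3 z ⟨hz, h1⟩)
  have hba : b ≤ a + 2 * m := by
    have := key (a + 1 * (2 * m)) (h.trans _ _ _ ha1 (per2 hk h a 1))
    lia
  have rba : (b : ℝ) ≤ a + 2 * m := by exact_mod_cast hba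
  have rab : (a : ℝ) + 2 ≤ b := by exact_mod_cast (show a + 2 ≤ b by lia)
  refine ⟨Pc m (((a : ℝ) + b) / 2), Real.cos (Real.pi * (((b : ℝ) - a - 1) / 2) / m), ?_, ?_⟩
  · intro z hz
    obtain ⟨j, h1, h2⟩ := shift_into hN (a + 1) z
    have h3 := key _ (h.trans _ _ _ hz (per2 hk h z j))
    rw [← Pc_per hm z j]
    have q1 : (b : ℝ) ≤ z + j * (2 * m) := by exact_mod_cast (show b ≤ z + j * (2 * m) by lia)
    have q2 : (z : ℝ) + j * (2 * m) ≤ a + 2 * m := by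
      exact_mod_cast (show z + j * (2 * m) ≤ a + 2 * m by lia)
    rw [dt_Pc hm, ← Real.cos_neg, show -(Real.pi * (((a : ℝ) + b) / 2 - (z + j * (2 * m))) / m) =
      Real.pi * ((z + j * (2 * m)) - ((a : ℝ) + b) / 2) / m by ring]
    apply cos_lt_aux hm <;> linarith
  · intro z hz
    obtain ⟨j, h1, h2⟩ := shift_into hN a z
    have h3 : E y (z + j * (2 * m)) := h.trans _ _ _ hz (per2 hk h z j)
    rw [← Pc_per hm z j]
    have n1 : z + j * (2 * m) ≠ a := by
      intro he; rw [he] at h3; exact hxy (h.trans _ _ _ ha1 (h.symm _ _ h3))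
    have n2 : z + j * (2 * m) ≠ b := by
      intro he; rw [he] at h3; exact hxy (h.trans _ _ _ hb1 (h.symm _ _ h3))
    have n3 : z + j * (2 * m) < b := by
      by_contra hc
      apply hxy
      refine h.trans _ _ _ ha1 (nc2 hk h a y b (z + j * (2 * m)) (by lia) (by lia) (by lia) (by lia)
        (h.trans _ _ _ (h.symm _ _ ha1) hb1) h3)
    have q1 : (z : ℝ) + j * (2 * m) ≤ b - 1 := by exact_mod_cast (show z + j * (2 * m) ≤ b - 1 by lia)
    have q2 : (a : ℝ) + 1 ≤ z + j * (2 * m) := by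
      exact_mod_cast (show a + 1 ≤ z + j * (2 * m) by lia)
    rw [dt_Pc hm]
    apply cos_gt_aux hm <;> linarith

omit hp hlt in
lemma sep0 {x : ℤ} (hx : ¬ E x (x + m)) : ∃ v : ℝ × ℝ, ∀ z : ℤ, E x z → dt v (Pc m z) < 0 := by
  obtain ⟨v, c, h1, h2⟩ := sep hm hk h hx
  refine ⟨v, fun z hz => ?_⟩
  have a1 := h1 z hz
  have a2 := h2 (z + m) ((inv_m hpm h x z).1 hz)
  push_cast at a2
  rw [Pc_add_m hm] at a2
  simp only [dt, Prod.fst_neg, Prod.snd_neg] at *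
  linarith

end



/-- the block of `x`. -/
def Blk (m p : ℕ) (E : ℤ → ℤ → Prop) (x : ℤ) : Set ℤ :=
  lab m '' {y | E x y} ∪ {i | |i| = (m:ℤ) + 1 ∧ E x (x + p)}

/-- the partition of `E`. -/
def WW (m p : ℕ) (E : ℤ → ℤ → Prop) : Set (Set ℤ) :=
  {B | ∃ x, B = Blk m p E x} ∪
    {B | (¬ ∃ x, E x (x + p)) ∧ ∃ i : ℤ, |i| = (m:ℤ) + 1 ∧ B = {i}}

section
variable {m p k : ℕ} (hm : 3 ≤ m) (hp : 0 < p) (hpm : p ∣ m) (hlt : p < m) (hk : k * p = 2 * m)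
  {E : ℤ → ℤ → Prop} (h : IsT p k E)
include hm

lemma lab_abs_ne (x : ℤ) : |lab m x| ≠ (m:ℤ) + 1 := by have := lab_abs hm x; lia

omit hm in
lemma big_mem_blk {i : ℤ} (hi : |i| = (m:ℤ) + 1) (hm : 3 ≤ m) {x : ℤ} : i ∈ Blk m p E x ↔ E x (x + p) := by
  constructor
  · rintro (⟨y, _, rfl⟩ | h)
    · exact absurd hi (lab_abs_ne hm y)
    · exact h.2
  · intro h; exact Or.inr ⟨hi, h⟩

lemma signed_cases' {a : ℤ} (h : a ∈ signedSet (m + 1)) : (∃ x, a = lab m x) ∨ |a| = (m:ℤ) + 1 := by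
  rcases signed_cases hm h with h | rfl | rfl
  · exact Or.inl h
  · right; rw [abs_of_nonneg (by lia)]
  · right; rw [abs_neg, abs_of_nonneg (by lia)]

omit hm in
lemma big_mem_signed {i : ℤ} (hi : |i| = (m:ℤ) + 1) : i ∈ signedSet (m + 1) := by
  unfold signedSet; rw [Set.mem_ofPred_eq]; push_cast; lia

lemma big_cases {i : ℤ} (hi : |i| = (m:ℤ) + 1) : i = m + 1 ∨ i = -((m:ℤ) + 1) := by
  rcases abs_cases i with ⟨h, _⟩ | ⟨h, _⟩ <;> lia

lemma g_big (s : ℕ) {i : ℤ} (hi : |i| = (m:ℤ) + 1) :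
    |(sigmaFun (m + 1) ∘ rhoFun (m + 1))^[s] i| = (m:ℤ) + 1 := by
  have e : |(m:ℤ) + 1| = m + 1 := abs_of_nonneg (by lia)
  rcases big_cases hm hi with rfl | rfl <;> rcases g_n hm s with ⟨h1, h2⟩ | ⟨h1, h2⟩ <;>
    simp only [h1, h2, abs_neg, e]

lemma g_big_inv (s : ℕ) {i : ℤ} (hi : |i| = (m:ℤ) + 1) : ∃ j : ℤ, |j| = (m:ℤ) + 1 ∧
    (sigmaFun (m + 1) ∘ rhoFun (m + 1))^[s] j = i := by
  have e : |(m:ℤ) + 1| = m + 1 := abs_of_nonneg (by lia)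
  rcases big_cases hm hi with rfl | rfl <;> rcases g_n hm s with ⟨h1, h2⟩ | ⟨h1, h2⟩
  · exact ⟨_, e, h1⟩
  · exact ⟨_, by rw [abs_neg, e], h2⟩
  · exact ⟨_, by rw [abs_neg, e], h2⟩
  · exact ⟨_, e, h1⟩

include hk h

lemma lab_mem_blk {x z : ℤ} : lab m z ∈ Blk m p E x ↔ E x z := by
  constructor
  · rintro (⟨y, hy, he⟩ | h1)
    · obtain ⟨j, rfl⟩ := lab_inj hm he
      exact h.trans _ _ _ hy (per2 hk h y j)
    · exact absurd h1.1 (lab_abs_ne hm z)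
  · intro h1; exact Or.inl ⟨z, h1, rfl⟩

omit hk in
lemma blk_congr {x y : ℤ} (hxy : E x y) : Blk m p E x = Blk m p E y := by
  have h1 : ∀ z, E x z ↔ E y z := fun z =>
    ⟨fun q => h.trans _ _ _ (h.symm _ _ hxy) q, fun q => h.trans _ _ _ hxy q⟩
  have h2 : E x (x + p) ↔ E y (y + p) :=
    ⟨cen_congr h hxy, cen_congr h (h.symm _ _ hxy)⟩
  unfold Blk
  simp only [h2]
  simp only [h1]

omit hk h in
lemma blk_sub {x : ℤ} : Blk m p E x ⊆ signedSet (m + 1) := by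
  rintro _ (⟨y, _, rfl⟩ | h1)
  · exact lab_mem hm y
  · exact big_mem_signed h1.1

include hpm
omit hk in
lemma blk_neg (x : ℤ) : (fun i : ℤ => -i) '' Blk m p E x = Blk m p E (x + m) := by
  have hc : E x (x + p) ↔ E (x + m) (x + m + p) := by
    rw [inv_m hpm h x (x + p)]
    have : x + (p:ℤ) + m = x + m + p := by ring
    rw [this]
  ext i
  constructor
  · rintro ⟨_, (⟨y, hy, rfl⟩ | h1), rfl⟩
    · left; exact ⟨y + m, (inv_m hpm h x y).1 hy, lab_add_m hm y⟩
    · right; exact ⟨by simpa using h1.1, hc.1 h1.2⟩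
  · rintro (⟨y, hy, rfl⟩ | h1)
    · refine ⟨lab m (y - m), Or.inl ⟨y - m, (inv_m hpm h _ _).2 (by simpa using hy), rfl⟩, ?_⟩
      simp only
      rw [← lab_add_m hm]; congr 1; ring
    · exact ⟨-i, Or.inr ⟨by simpa using h1.1, hc.2 h1.2⟩, by simp⟩

omit hk hpm in
lemma blk_g (s : ℕ) (hps : p ∣ s) (x : ℤ) :
    (sigmaFun (m + 1) ∘ rhoFun (m + 1))^[s] '' Blk m p E x = Blk m p E (x + s) := by
  have hc : E x (x + p) ↔ E (x + s) (x + s + p) := by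
    rw [inv_m hps h x (x + p)]
    have : x + (p:ℤ) + s = x + s + p := by ring
    rw [this]
  ext i
  constructor
  · rintro ⟨_, (⟨y, hy, rfl⟩ | h1), rfl⟩
    · left; exact ⟨y + s, (inv_m hps h x y).1 hy, (g_lab hm s y).symm⟩
    · right; exact ⟨g_big hm s h1.1, hc.1 h1.2⟩
  · rintro (⟨y, hy, rfl⟩ | h1)
    · refine ⟨lab m (y - s), Or.inl ⟨y - s, (inv_m hps h _ _).2 (by simpa using hy), rfl⟩, ?_⟩
      rw [g_lab hm]; congr 1; ring
    · obtain ⟨j, hj, rfl⟩ := g_big_inv hm s h1.1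
      exact ⟨j, Or.inr ⟨hj, hc.2 h1.2⟩, rfl⟩

include hp hlt

omit hpm in
lemma cen_of_pair {x i : ℤ} (h1 : i ∈ Blk m p E x) (h2 : -i ∈ Blk m p E x) : E x (x + p) := by
  rcases h1 with ⟨y, hy, rfl⟩ | h1
  · rw [← lab_add_m hm, lab_mem_blk hm hk h] at h2
    have := cen_of_m hp hlt hk h (h.trans _ _ _ (h.symm _ _ hy) h2)
    exact cen_congr h (h.symm _ _ hy) this
  · exact h1.2

lemma WW_part : IsDnPartition (m + 1) (WW m p E) := by
  have en : |(m:ℤ) + 1| = m + 1 := abs_of_nonneg (by lia)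
  refine ⟨⟨?_, ?_, ?_⟩, ?_, ?_, ?_⟩
  · rintro B (⟨x, rfl⟩ | ⟨_, i, _, rfl⟩)
    · exact ⟨lab m x, (lab_mem_blk hm hk h).2 (h.refl x)⟩
    · exact ⟨i, rfl⟩
  · rintro B (⟨x, rfl⟩ | ⟨_, i, hi, rfl⟩)
    · exact blk_sub hm
    · rintro _ rfl; exact big_mem_signed hi
  · intro a ha
    rcases signed_cases' hm ha with ⟨x, rfl⟩ | ha
    · refine ⟨Blk m p E x, ⟨Or.inl ⟨x, rfl⟩, (lab_mem_blk hm hk h).2 (h.refl x)⟩, ?_⟩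
      rintro B ⟨(⟨y, rfl⟩ | ⟨_, i, hi, rfl⟩), hB⟩
      · exact blk_congr hm h ((lab_mem_blk hm hk h).1 hB)
      · rw [Set.mem_singleton_iff] at hB; rw [← hB] at hi; exact absurd hi (lab_abs_ne hm x)
    · by_cases hc : ∃ x, E x (x + p)
      · obtain ⟨x, hx⟩ := hc
        refine ⟨Blk m p E x, ⟨Or.inl ⟨x, rfl⟩, (big_mem_blk ha hm).2 hx⟩, ?_⟩
        rintro B ⟨(⟨y, rfl⟩ | ⟨hn, i, hi, rfl⟩), hB⟩
        · exact blk_congr hm h (cen_unique hp hlt hk h ((big_mem_blk ha hm).1 hB) hx)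
        · exact absurd ⟨x, hx⟩ hn
      · refine ⟨{a}, ⟨Or.inr ⟨hc, a, ha, rfl⟩, rfl⟩, ?_⟩
        rintro B ⟨(⟨y, rfl⟩ | ⟨hn, i, hi, rfl⟩), hB⟩
        · exact absurd ⟨y, (big_mem_blk ha hm).1 hB⟩ hc
        · rw [Set.mem_singleton_iff] at hB; rw [hB]
  · rintro B (⟨x, rfl⟩ | ⟨hn, i, hi, rfl⟩)
    · exact Or.inl ⟨x + m, blk_neg hm hpm h x⟩
    · exact Or.inr ⟨hn, -i, by simpa using hi, by simp⟩
  · rintro B (⟨x, rfl⟩ | ⟨hn, i, hi, rfl⟩) B' (⟨x', rfl⟩ | ⟨hn', i', hi', rfl⟩) ⟨j, hj, hj'⟩ ⟨l, hl, hl'⟩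
    · exact blk_congr hm h (cen_unique hp hlt hk h (cen_of_pair hm hp hlt hk h hj hj')
        (cen_of_pair hm hp hlt hk h hl hl'))
    · rw [Set.mem_singleton_iff] at hl hl'
      have : |i'| = 0 := by rw [abs_eq_zero]; lia
      lia
    · rw [Set.mem_singleton_iff] at hj hj'
      have : |i| = 0 := by rw [abs_eq_zero]; lia
      lia
    · rw [Set.mem_singleton_iff] at hj hj'
      have : |i| = 0 := by rw [abs_eq_zero]; lia
      lia
  · rintro B (⟨x, rfl⟩ | ⟨hn, i, hi, rfl⟩) j he
    · have c := cen_of_pair hm hp hlt hk h (x := x) (i := j) (by rw [he]; simp) (by rw [he]; simp)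
      have a1 : ((m:ℤ) + 1) ∈ Blk m p E x := (big_mem_blk en hm).2 c
      have a2 := (lab_mem_blk hm hk h).2 (h.refl x)
      rw [he] at a1 a2
      have b := lab_bd hm x
      simp only [Set.mem_insert_iff, Set.mem_singleton_iff] at a1 a2
      lia
    · have a1 : j ∈ ({i} : Set ℤ) := by rw [he]; simp
      have a2 : -j ∈ ({i} : Set ℤ) := by rw [he]; simp
      rw [Set.mem_singleton_iff] at a1 a2
      have : |i| = 0 := by rw [abs_eq_zero]; lia
      lia

lemma blk_disj {x y : ℤ} (hxy : ¬ E x y) {u : ℝ × ℝ} (h1 : u ∈ hullOf (m + 1) (Blk m p E x))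
    (h2 : u ∈ hullOf (m + 1) (Blk m p E y)) : False := by
  obtain ⟨v, c, g1, g2⟩ := sep hm hk h hxy
  have a1 := hull_lt (v := v) (c := c) (by
    rintro b (⟨z, hz, rfl⟩ | ⟨hb, hc⟩)
    · rw [pt_lab hm]; exact g1 z hz
    · rw [pt_n hb]
      have b1 := g1 x (h.refl x)
      have b2 := g1 (x + m) (m_of_cen hpm h hc)
      push_cast at b2
      rw [Pc_add_m hm] at b2
      simp only [dt, Prod.fst_neg, Prod.snd_neg] at *
      linarith) u h1
  have a2 := hull_gt (v := v) (c := c) (by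
    rintro b (⟨z, hz, rfl⟩ | ⟨hb, hc⟩)
    · rw [pt_lab hm]; exact g2 z hz
    · rw [pt_n hb]
      have b1 := g2 y (h.refl y)
      have b2 := g2 (y + m) (m_of_cen hpm h hc)
      push_cast at b2
      rw [Pc_add_m hm] at b2
      simp only [dt, Prod.fst_neg, Prod.snd_neg] at *
      linarith) u h2
  linarith

omit hm hp hpm hlt hk h in
lemma hull_big {i : ℤ} (hi : |i| = (m:ℤ) + 1) : hullOf (m + 1) {i} = {(0, 0)} := by
  unfold hullOf; rw [Set.image_singleton, pt_n hi, convexHull_singleton]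

lemma blk_zero {x : ℤ} (hn : ¬ E x (x + p)) : (0, 0) ∉ hullOf (m + 1) (Blk m p E x) := by
  intro h0
  obtain ⟨v, hv⟩ := sep0 hm hpm hk h (x := x) (fun q => hn (cen_of_m hp hlt hk h q))
  have := hull_lt (v := v) (c := 0) (by
    rintro b (⟨z, hz, rfl⟩ | ⟨hb, hc⟩)
    · rw [pt_lab hm]; exact hv z hz
    · exact absurd hc hn) _ h0
  simp [dt] at this

lemma WW_NCD : WW m p E ∈ NCD (m + 1) := by
  refine ⟨WW_part hm hp hpm hlt hk h, ?_⟩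
  have sub : ∀ S : Set (ℝ × ℝ), intrinsicInterior ℝ S ⊆ S := fun S => intrinsicInterior_subset
  intro B hB B' hB' hne hcr
  obtain ⟨hh, u, hu1, hu2⟩ : hullOf (m + 1) B ≠ hullOf (m + 1) B' ∧
      ∃ u, u ∈ hullOf (m + 1) B ∧ u ∈ hullOf (m + 1) B' := by
    obtain ⟨hh, ⟨u, h1, h2⟩ | ⟨u, h1, h2⟩⟩ := hcr
    · exact ⟨hh, u, sub _ h2, h1⟩
    · exact ⟨hh, u, h1, sub _ h2⟩
  rcases hB with ⟨x, rfl⟩ | ⟨hn, i, hi, rfl⟩ <;> rcases hB' with ⟨x', rfl⟩ | ⟨hn', i', hi', rfl⟩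
  · exact blk_disj hm hp hpm hlt hk h (fun q => hne (blk_congr hm h q)) hu1 hu2
  · rw [hull_big hi', Set.mem_singleton_iff] at hu2
    rw [hu2] at hu1
    exact blk_zero hm hp hpm hlt hk h (fun q => hn' ⟨_, q⟩) hu1
  · rw [hull_big hi, Set.mem_singleton_iff] at hu1
    rw [hu1] at hu2
    exact blk_zero hm hp hpm hlt hk h (fun q => hn ⟨_, q⟩) hu2
  · exact hh (by rw [hull_big hi, hull_big hi'])

omit hpm hk hp hlt in
lemma WW_inv (s : ℕ) (hps : p ∣ s) : InvUnder ((sigmaFun (m + 1) ∘ rhoFun (m + 1))^[s]) (WW m p E) := by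
  unfold InvUnder
  ext B
  constructor
  · rintro ⟨_, (⟨x, rfl⟩ | ⟨hn, i, hi, rfl⟩), rfl⟩
    · exact Or.inl ⟨x + s, blk_g hm h s hps x⟩
    · exact Or.inr ⟨hn, _, g_big hm s hi, by simp⟩
  · rintro (⟨x, rfl⟩ | ⟨hn, i, hi, rfl⟩)
    · refine ⟨Blk m p E (x - s), Or.inl ⟨_, rfl⟩, ?_⟩
      simp only
      rw [blk_g hm h s hps]; congr 1; ring
    · obtain ⟨j, hj, rfl⟩ := g_big_inv hm s hi
      exact ⟨{j}, Or.inr ⟨hn, j, hj, rfl⟩, by simp⟩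

/-- recovering the relation. -/
def EE (m : ℕ) (w : Set (Set ℤ)) (x y : ℤ) : Prop := ∃ B ∈ w, lab m x ∈ B ∧ lab m y ∈ B

omit hpm hp hlt in
lemma EE_WW : EE m (WW m p E) = E := by
  funext x y
  apply propext
  constructor
  · rintro ⟨B, (⟨z, rfl⟩ | ⟨hn, i, hi, rfl⟩), h1, h2⟩
    · rw [lab_mem_blk hm hk h] at h1 h2
      exact h.trans _ _ _ (h.symm _ _ h1) h2
    · rw [Set.mem_singleton_iff] at h1; rw [← h1] at hi; exact absurd hi (lab_abs_ne hm x)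
  · intro hxy
    exact ⟨Blk m p E x, Or.inl ⟨x, rfl⟩, (lab_mem_blk hm hk h).2 (h.refl x), (lab_mem_blk hm hk h).2 hxy⟩

end



section
variable {m : ℕ} (hm : 3 ≤ m) {w : Set (Set ℤ)} (hw : w ∈ NCD (m + 1)) 
include hw

omit hm in
lemma w_uniq {B B' : Set ℤ} (hB : B ∈ w) (hB' : B' ∈ w) {a : ℤ} (h1 : a ∈ B) (h2 : a ∈ B') : B = B' :=
  (hw.1.1.2.2 a (hw.1.1.2.1 B hB h1)).unique ⟨hB, h1⟩ ⟨hB', h2⟩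

omit hm in
lemma w_ex {a : ℤ} (ha : a ∈ signedSet (m + 1)) : ∃ B ∈ w, a ∈ B := by
  obtain ⟨B, h, _⟩ := hw.1.1.2.2 a ha
  exact ⟨B, h⟩

lemma EE_trans {x y z : ℤ} (h1 : EE m w x y) (h2 : EE m w y z) : EE m w x z := by
  obtain ⟨B, hB, a1, a2⟩ := h1
  obtain ⟨B', hB', b1, b2⟩ := h2
  obtain rfl := w_uniq hw hB hB' a2 b1
  exact ⟨B, hB, a1, b2⟩

omit hw in
lemma EE_symm {x y : ℤ} (h1 : EE m w x y) : EE m w y x := by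
  obtain ⟨B, hB, a1, a2⟩ := h1
  exact ⟨B, hB, a2, a1⟩

include hm

lemma EE_per (x j : ℤ) : EE m w x (x + j * (2 * m)) := by
  obtain ⟨B, hB, h⟩ := w_ex hw (lab_mem hm x)
  exact ⟨B, hB, h, by rw [lab_per hm]; exact h⟩

lemma EE_refl (x : ℤ) : EE m w x x := by simpa using EE_per hm hw x 0

lemma EE_m {x y : ℤ} (h : EE m w x y) : EE m w (x + m) (y + m) := by
  obtain ⟨B, hB, a1, a2⟩ := h
  refine ⟨_, hw.1.2.1 B hB, ?_, ?_⟩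
  · rw [lab_add_m hm]; exact ⟨_, a1, rfl⟩
  · rw [lab_add_m hm]; exact ⟨_, a2, rfl⟩

variable {s : ℕ} (hi : InvUnder ((sigmaFun (m + 1) ∘ rhoFun (m + 1))^[s]) w)
include hi

/-- shifts preserving the relation -/
def TT (m : ℕ) (w : Set (Set ℤ)) : AddSubgroup ℤ where
  carrier := {d | ∀ x y, EE m w x y ↔ EE m w (x + d) (y + d)}
  zero_mem' := by intro x y; simp
  add_mem' := by
    intro a b ha hb x y
    rw [ha x y, hb, add_assoc, add_assoc]
  neg_mem' := by
    intro a ha x y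
    have := ha (x + -a) (y + -a)
    simp only [neg_add_cancel_right] at this
    exact this.symm

lemma s_mem_TT : (s : ℤ) ∈ TT m w := by
  intro x y
  constructor
  · rintro ⟨B, hB, h1, h2⟩
    refine ⟨_, hi ▸ Set.mem_image_of_mem _ hB, ?_, ?_⟩
    · exact ⟨_, h1, g_lab hm s x⟩
    · exact ⟨_, h2, g_lab hm s y⟩
  · rintro ⟨B, hB, h1, h2⟩
    unfold InvUnder at hi
    rw [← hi] at hB
    obtain ⟨B0, hB0, rfl⟩ := hB
    have key : ∀ x, lab m (x + s) ∈ (sigmaFun (m + 1) ∘ rhoFun (m + 1))^[s] '' B0 → lab m x ∈ B0 := by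
      rintro x ⟨a, ha, he⟩
      rcases signed_cases' hm (hw.1.1.2.1 _ hB0 ha) with ⟨z, rfl⟩ | hb
      · rw [g_lab hm] at he
        obtain ⟨j, hj⟩ := lab_inj hm he
        obtain rfl : x = z + j * (2 * m) := by linarith
        rw [lab_per hm]; exact ha
      · have := g_big hm s hb
        rw [he] at this
        exact absurd this (lab_abs_ne hm _)
    exact ⟨B0, hB0, key x h1, key y h2⟩

omit hi in
lemma m_mem_TT : (m : ℤ) ∈ TT m w := by
  intro x y
  constructor
  · exact EE_m hm hw
  · intro h
    have h2 := EE_m hm hw h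
    have a := EE_per hm hw x 1
    have b := EE_per hm hw y 1
    have e : ∀ x : ℤ, x + m + m = x + 1 * (2 * m) := by intro x; ring
    rw [e, e] at h2
    exact EE_trans hw a (EE_trans hw h2 (EE_symm b))

lemma gcd_mem_TT : ((Nat.gcd m s : ℕ) : ℤ) ∈ TT m w := by
  rw [Nat.gcd_eq_gcd_ab, mul_comm (m : ℤ), mul_comm (s : ℤ)]
  exact add_mem (by simpa using (TT m w).zsmul_mem (m_mem_TT hm hw) (m.gcdA s))
    (by simpa using (TT m w).zsmul_mem (s_mem_TT hm hw hi) (m.gcdB s))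

lemma EE_IsT {k : ℕ} (hk : k * Nat.gcd m s = 2 * m) : IsT (Nat.gcd m s) k (EE m w) where
  refl := EE_refl hm hw
  symm := fun x y h => EE_symm h
  trans := fun x y z h1 h2 => EE_trans hw h1 h2
  per := by
    intro x
    have e : ((k : ℤ) * (Nat.gcd m s : ℕ)) = 2 * m := by exact_mod_cast hk
    rw [e]
    simpa using EE_per hm hw x 1
  inv := gcd_mem_TT hm hw hi
  nc := by
    intro x y z t h1 h2 h3 h4 e1 e2
    have e : ((k : ℤ) * (Nat.gcd m s : ℕ)) = 2 * m := by exact_mod_cast hk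
    rw [e] at h4
    obtain ⟨B, hB, a1, a2⟩ := e1
    obtain ⟨B', hB', b1, b2⟩ := e2
    by_cases he : B = B'
    · subst he; exact ⟨B, hB, a1, b1⟩
    · exfalso
      refine hw.2 B hB B' hB' he (crosses_of hm (hw.1.1.2.1 B hB) (hw.1.1.2.1 B' hB') ?_ h1 h2 h3 h4
        a1 a2 b1 b2)
      intro x q1 q2
      exact he (w_uniq hw hB hB' q1 q2)

variable (hlt : Nat.gcd m s < m)

omit hi in
lemma big_of_cen {p : ℕ} (hp : 0 < p) (hlt : p < m) {B : Set ℤ} (hB : B ∈ w) {x i : ℤ} (hx : lab m x ∈ B) (hxp : EE m w x (x + p))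
    (hxm : EE m w x (x + m)) (habs : |i| = (m:ℤ) + 1) : i ∈ B := by
  have mm : ∀ y, EE m w x y → lab m y ∈ B := by
    rintro y ⟨B', hB', h1, h2⟩
    rwa [w_uniq hw hB hB' hx h1]
  have mp : ∀ y : ℤ, EE m w x y → Pc m y ∈ pt (m + 1) '' B := by
    intro y hy
    rw [← pt_lab hm]; exact Set.mem_image_of_mem _ (mm y hy)
  have h4 : EE m w x (x + p + m) := EE_trans hw hxm (EE_m hm hw hxp)
  have h0 : ((0:ℝ), (0:ℝ)) ∈ interior (hullOf (m + 1) B) := by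
    apply quad_interior (mp x (EE_refl hm hw x)) (a := Pc m x) (b := Pc m (x + p))
    · have := mp _ hxm
      push_cast at this
      rwa [Pc_add_m hm] at this
    · have := mp _ hxp
      push_cast at this
      exact this
    · have := mp _ h4
      push_cast at this
      rwa [Pc_add_m hm] at this
    · have hm' : (0 : ℝ) < m := by positivity
      have hp' : (0 : ℝ) < p := by exact_mod_cast hp
      have hl' : (p : ℝ) < m := by exact_mod_cast hlt
      have pp := Real.pi_pos
      have e : (Pc m x).1 * (Pc m (x + p)).2 - (Pc m x).2 * (Pc m (x + p)).1 = - Real.sin (Real.pi * p / m) := by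
        rw [show Real.pi * (p:ℝ) / m = Real.pi * (x + p) / m - Real.pi * x / m by ring, Real.sin_sub]
        simp only [Pc]; ring
      rw [e]
      have := Real.sin_pos_of_pos_of_lt_pi (x := Real.pi * p / m) (by positivity)
        (by rw [div_lt_iff₀ hm']; nlinarith)
      linarith
  by_contra hc
  obtain ⟨B', hB', hi'⟩ := w_ex hw (big_mem_signed habs)
  have hne : B ≠ B' := by rintro rfl; exact hc hi'
  refine hw.2 B hB B' hB' hne ⟨?_, Or.inl ⟨(0, 0), ?_, interior_subset_intrinsicInterior h0⟩⟩
  · intro he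
    have := mem_hull hm hx
    rw [he] at this
    exact hne (w_uniq hw hB hB' hx (mem_of_mem_hull hm (hw.1.1.2.1 B' hB') this))
  · rw [← pt_n habs]; exact subset_convexHull ℝ _ (Set.mem_image_of_mem _ hi')

include hlt
lemma cen_of_big {k : ℕ} (hk : k * Nat.gcd m s = 2 * m) (hp : 0 < Nat.gcd m s) {B : Set ℤ} (hB : B ∈ w)
    {x i : ℤ} (hx : lab m x ∈ B) (habs : |i| = (m:ℤ) + 1)
    (hiB : i ∈ B) : EE m w x (x + (Nat.gcd m s : ℕ)) := by
  have hT := EE_IsT hm hw hi hk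
  set g := (sigmaFun (m + 1) ∘ rhoFun (m + 1))^[s] with hg
  have gw : ∀ B ∈ w, g '' B ∈ w := fun B hB => hi ▸ Set.mem_image_of_mem _ hB
  have gg : g (g i) = i := by
    rcases big_cases hm habs with rfl | rfl <;> rcases g_n hm s with ⟨h1, h2⟩ | ⟨h1, h2⟩ <;>
      rw [← hg] at h1 h2 <;> simp only [h1, h2]
  have hBB : B = g '' (g '' B) := w_uniq hw hB (gw _ (gw _ hB)) hiB ⟨_, ⟨_, hiB, rfl⟩, gg⟩
  have hs2 : EE m w x (x + 2 * s) := by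
    refine ⟨B, hB, hx, ?_⟩
    rw [hBB]
    refine ⟨_, ⟨_, hx, g_lab hm s x⟩, ?_⟩
    rw [hg, g_lab hm]; congr 1; ring
  let U : AddSubgroup ℤ :=
    { carrier := {d | d ∈ TT m w ∧ EE m w x (x + d)}
      zero_mem' := ⟨zero_mem _, by simpa using EE_refl hm hw x⟩
      add_mem' := by
        rintro a b ⟨ha, ha'⟩ ⟨hb, hb'⟩
        refine ⟨add_mem ha hb, EE_trans hw ha' ?_⟩
        have := (ha x (x + b)).1 hb'
        rwa [show x + (a + b) = x + b + a by ring]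
      neg_mem' := by
        rintro a ⟨ha, ha'⟩
        refine ⟨neg_mem ha, ?_⟩
        have := ((neg_mem ha) x (x + a)).1 ha'
        rw [add_neg_cancel_right] at this
        exact EE_symm this }
  have u1 : (2 * m : ℤ) ∈ U := by
    refine ⟨?_, by simpa using EE_per hm hw x 1⟩
    rw [two_mul]; exact add_mem (m_mem_TT hm hw) (m_mem_TT hm hw)
  have u2 : (2 * s : ℤ) ∈ U := by
    refine ⟨?_, hs2⟩
    rw [two_mul]; exact add_mem (s_mem_TT hm hw hi) (s_mem_TT hm hw hi)
  have u3 : (2 * (Nat.gcd m s : ℕ) : ℤ) ∈ U := by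
    rw [Nat.gcd_eq_gcd_ab, show 2 * ((m:ℤ) * m.gcdA s + s * m.gcdB s) =
      m.gcdA s * (2 * m) + m.gcdB s * (2 * s) by ring]
    exact add_mem (by simpa using U.zsmul_mem u1 (m.gcdA s)) (by simpa using U.zsmul_mem u2 (m.gcdB s))
  have e1 := u3.2
  obtain ⟨c, hc⟩ := Nat.gcd_dvd_left m s
  set p := Nat.gcd m s
  have e2 := (hT.inv _ _).1 e1
  have hc2 : 2 ≤ c := by
    by_contra hlt'
    have : c = 0 ∨ c = 1 := by lia
    rcases this with rfl | rfl <;> lia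
  have : 2 * p ≤ m := by rw [hc]; nlinarith
  exact nc2 hk hT x (x + p) (x + 2 * p) (x + 2 * p + p) (by lia) (by lia) (by lia) (by lia) e1 e2

lemma WW_EE {k : ℕ} (hk : k * Nat.gcd m s = 2 * m) (hp : 0 < Nat.gcd m s) :
    WW m (Nat.gcd m s) (EE m w) = w := by
  have hT := EE_IsT hm hw hi hk
  have hpm := Nat.gcd_dvd_left m s
  have cb : ∀ B ∈ w, ∀ x i : ℤ, lab m x ∈ B → |i| = (m:ℤ) + 1 →
      (i ∈ B ↔ EE m w x (x + (Nat.gcd m s : ℕ))) := by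
    intro B hB x i hx habs
    exact ⟨cen_of_big hm hw hi hlt hk hp hB hx habs,
      fun q => big_of_cen hm hw hp hlt hB hx q (m_of_cen hpm hT q) habs⟩
  have c1 : ∀ B ∈ w, ∀ x : ℤ, lab m x ∈ B → B = Blk m (Nat.gcd m s) (EE m w) x := by
    intro B hB x hx
    ext a
    have hsub : a ∈ B ∨ a ∈ Blk m (Nat.gcd m s) (EE m w) x → a ∈ signedSet (m + 1) := by
      rintro (q | q)
      · exact hw.1.1.2.1 B hB q
      · exact blk_sub hm q
    by_cases ha : a ∈ signedSet (m + 1)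
    · rcases signed_cases' hm ha with ⟨y, rfl⟩ | hbig
      · rw [lab_mem_blk hm hk hT]
        constructor
        · intro q; exact ⟨B, hB, hx, q⟩
        · rintro ⟨B', hB', q1, q2⟩
          rwa [w_uniq hw hB hB' hx q1]
      · rw [big_mem_blk hbig hm]; exact cb B hB x a hx hbig
    · tauto
  have c2 : ∀ B ∈ w, (∀ x, lab m x ∉ B) → (¬ ∃ x, EE m w x (x + (Nat.gcd m s : ℕ))) ∧
      ∃ i : ℤ, |i| = (m:ℤ) + 1 ∧ B = {i} := by
    intro B hB hno
    have hbig : ∀ i ∈ B, |i| = (m:ℤ) + 1 := by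
      intro i hiB
      rcases signed_cases' hm (hw.1.1.2.1 B hB hiB) with ⟨y, rfl⟩ | hb
      · exact absurd hiB (hno y)
      · exact hb
    obtain ⟨i, hiB⟩ := hw.1.1.1 B hB
    have hia := hbig i hiB
    constructor
    · rintro ⟨x, hx⟩
      obtain ⟨B', hB', hx'⟩ := w_ex hw (lab_mem hm x)
      have := (cb B' hB' x i hx' hia).2 hx
      rw [w_uniq hw hB hB' hiB this] at hno
      exact hno x hx'
    · refine ⟨i, hia, ?_⟩
      by_contra hne
      apply hw.1.2.2.2 B hB i
      have : -i ∈ B := by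
        by_contra hc
        apply hne
        ext j
        rw [Set.mem_singleton_iff]
        constructor
        · intro hj
          rcases abs_eq_abs.1 ((hbig j hj).trans hia.symm) with q | q
          · exact q
          · rw [q] at hj; exact absurd hj hc
        · rintro rfl; exact hiB
      ext j
      simp only [Set.mem_insert_iff, Set.mem_singleton_iff]
      constructor
      · intro hj
        exact abs_eq_abs.1 ((hbig j hj).trans hia.symm)
      · rintro (rfl | rfl) <;> assumption
  ext B
  constructor
  · rintro (⟨x, rfl⟩ | ⟨hn, i, habs, rfl⟩)
    · obtain ⟨B', hB', hx'⟩ := w_ex hw (lab_mem hm x)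
      rw [← c1 B' hB' x hx']; exact hB'
    · obtain ⟨B', hB', hi'⟩ := w_ex hw (big_mem_signed habs)
      obtain ⟨_, j, _, rfl⟩ := c2 B' hB' (fun x hx => hn ⟨x, (cb B' hB' x i hx habs).1 hi'⟩)
      rw [Set.mem_singleton_iff] at hi'
      rw [hi']; exact hB'
  · intro hB
    by_cases hx : ∃ x, lab m x ∈ B
    · obtain ⟨x, hx⟩ := hx
      exact Or.inl ⟨x, c1 B hB x hx⟩
    · push Not at hx
      exact Or.inr (c2 B hB hx)

end

theorem main_count (m s : ℕ) (hm : 3 ≤ m) (hs : 0 < s) (hdvd : s ∣ 2 * m) (hs1 : s ≠ m) (hs2 : s ≠ 2 * m) :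
    Nat.card {w : Set (Set ℤ) // w ∈ NCD (m + 1) ∧ InvUnder ((sigmaFun (m + 1) ∘ rhoFun (m + 1))^[s]) w} =
      (2 * Nat.gcd m s).choose (Nat.gcd m s) := by
  have hp : 0 < Nat.gcd m s := Nat.gcd_pos_of_pos_right _ hs
  have hpm := Nat.gcd_dvd_left m s
  have hps := Nat.gcd_dvd_right m s
  have hlt : Nat.gcd m s < m := by
    apply lt_of_le_of_ne (Nat.le_of_dvd (by lia) hpm)
    intro he
    rw [he] at hps
    obtain ⟨c, rfl⟩ := hps
    obtain ⟨d, hd⟩ := hdvd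
    have hcd : c * d = 2 := by
      have : m * (c * d) = m * 2 := by rw [← mul_assoc, ← hd, mul_comm]
      exact Nat.eq_of_mul_eq_mul_left (by lia) this
    have hc : c ∣ 2 := ⟨d, hcd.symm⟩
    rcases (Nat.dvd_prime Nat.prime_two).1 hc with rfl | rfl
    · simp at hs1
    · exact hs2 (by ring)
  obtain ⟨c, hc⟩ := hpm
  have hk : (2 * c) * Nat.gcd m s = 2 * m := by
    conv_rhs => rw [hc]
    ring
  have hc2 : 2 ≤ c := by
    by_contra hlt'
    have : c = 0 ∨ c = 1 := by lia
    rcases this with rfl | rfl <;> lia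
  haveI : NeZero (Nat.gcd m s) := ⟨hp.ne'⟩
  rw [← card_T (Nat.gcd m s) (2 * c) (by lia)]
  symm
  have hpm := Nat.gcd_dvd_left m s
  refine Nat.card_eq_of_bijective (fun E => ⟨WW m (Nat.gcd m s) E.1,
    WW_NCD hm hp hpm hlt hk E.2, WW_inv hm E.2 s hps⟩) ⟨?_, ?_⟩
  · rintro ⟨E, hE⟩ ⟨E', hE'⟩ he
    have he' : WW m (Nat.gcd m s) E = WW m (Nat.gcd m s) E' := congrArg Subtype.val he
    apply Subtype.ext
    change E = E'
    rw [← EE_WW hm hk hE, ← EE_WW hm hk hE', he']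
  · rintro ⟨w, hw, hi⟩
    exact ⟨⟨EE m w, EE_IsT hm hw hi hk⟩, Subtype.ext (WW_EE hm hw hi hlt hk hp)⟩


/-- Let `s` be a positive divisor of `2n-2` with `s ≠ n-1` and `s ≠ 2n-2`, and let
`p = gcd(n-1, s)`. The number of elements of `NC^D(n)` invariant under `(σ∘ρ)^s` equals
`C(2p, p)`. -/
theorem number_of_sigma_rho_pow_invariant_NCD (n s : ℕ) (hn : 4 ≤ n)
    (hs : 0 < s) (hdvd : s ∣ 2 * n - 2) (hs1 : s ≠ n - 1) (hs2 : s ≠ 2 * n - 2) :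
    Nat.card {w : Set (Set ℤ) // w ∈ NCD n ∧ InvUnder ((sigmaFun n ∘ rhoFun n)^[s]) w} =
      (2 * Nat.gcd (n - 1) s).choose (Nat.gcd (n - 1) s) := by
  obtain ⟨m, rfl⟩ : ∃ m, n = m + 1 := ⟨n - 1, by lia⟩
  have e : 2 * (m + 1) - 2 = 2 * m := by lia
  rw [e] at hdvd hs2
  simp only [Nat.add_sub_cancel] at hs1 ⊢
  exact main_count m s (by lia) hs hdvd hs1 hs2
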